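/- arXiv:1512.00273 — 4 statements merged into one kernel-verified Lean document; each statement's English description precedes it below -/
import Mathlib

section
/- Let M be a Λ-module of finite cardinality. Then Ext^i_Λ(M,Λ) = 0 for all i ≠ r+1, and Ext^{r+1}_Λ(M,Λ) is a module of finite cardinality equal to the cardinality of M. -/
open CategoryTheory Opposite

set_option maxHeartbeats 1000000
set_option synthInstance.maxHeartbeats 400000

noncomputable section

/-- The valuation ring of a finite extension `K` of `ℚ_p`, realized as the integral
closure of `ℤ_p` in `K`. -/
abbrev PadicValRing (p : ℕ) [Fact p.Prime] (K : Type) [Field K] [Algebra ℚ_[p] K]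
    [Algebra ℤ_[p] K] [IsScalarTower ℤ_[p] ℚ_[p] K] : Type :=
  integralClosure ℤ_[p] K

/-- The formal power series ring `Λ = O⟦t₁, …, t_r⟧` over the valuation ring `O`. -/
abbrev IwasawaAlgebra (p : ℕ) [Fact p.Prime] (K : Type) [Field K] [Algebra ℚ_[p] K]
    [Algebra ℤ_[p] K] [IsScalarTower ℤ_[p] ℚ_[p] K] (r : ℕ) : Type :=
  MvPowerSeries (Fin r) (PadicValRing p K)

/-- `Ext^i_R(M, N)`, as a type (carrying its natural `R`-module structure). -/
abbrev ExtGroup (R : Type) [CommRing R] (i : ℕ) (M N : Type) [AddCommGroup M] [Module R M]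
    [AddCommGroup N] [Module R N] : Type :=
  ((Ext R (ModuleCat R) i).obj (op (ModuleCat.of R M))).obj (ModuleCat.of R N)

/-- The height of an ideal: the infimum of the heights of the prime ideals containing it. -/
noncomputable def idealHeight {R : Type} [CommRing R] (I : Ideal R) : ℕ∞ :=
  ⨅ P : {P : PrimeSpectrum R // I ≤ P.asIdeal}, Order.height P.1

section
open CategoryTheory.Limits

theorem addEquiv_of_surj {Z A B : Type*} [AddCommGroup Z] [AddCommGroup A] [AddCommGroup B]
    (f : Z →+ A) (g : Z →+ B) (hf : Function.Surjective f) (hg : Function.Surjective g)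
    (h : ∀ z, f z = 0 ↔ g z = 0) : Nonempty (A ≃+ B) := by
  have hk : f.ker = g.ker := by ext z; simpa using h z
  exact ⟨(QuotientAddGroup.quotientKerEquivOfSurjective f hf).symm.trans
    ((QuotientAddGroup.quotientAddEquivOfEq hk).trans
      (QuotientAddGroup.quotientKerEquivOfSurjective g hg))⟩

theorem bridge_succ {R : Type} [CommRing R] (X Y : ModuleCat.{0} R) (n : ℕ) :
    Nonempty (((Ext R (ModuleCat R) (n+1)).obj (op X)).obj Y ≃+ Abelian.Ext.{0} X Y (n+1)) := by
  let P := projectiveResolution X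
  let T := P.complex.linearYonedaObj R Y
  let S := T.sc' n (n+1) (n+2)
  let e1 : ((Ext R (ModuleCat R) (n+1)).obj (op X)).obj Y ≃+ S.moduleCatLeftHomologyData.H :=
    (P.isoExt (R := R) (n+1) Y ≪≫ T.homologyIsoSc' n (n+1) (n+2) (by simp) (by simp) ≪≫
      S.moduleCatHomologyIso).toLinearEquiv.toAddEquiv
  let Z := LinearMap.ker S.g.hom
  let f : Z →+ S.moduleCatLeftHomologyData.H :=
    (LinearMap.range S.moduleCatToCycles).mkQ.toAddMonoidHom
  have hZ : ∀ z : Z, P.complex.d (n+2) (n+1) ≫ (z.1 : P.complex.X (n+1) ⟶ Y) = 0 := fun z => z.2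
  let g : Z →+ Abelian.Ext.{0} X Y (n+1) := AddMonoidHom.mk'
    (fun z => P.extMk (z.1 : P.complex.X (n+1) ⟶ Y) (n+2) rfl (hZ z))
    (fun a b => (P.add_extMk (a.1 : P.complex.X (n+1) ⟶ Y) b.1 (n+2) rfl (hZ a) (hZ b)).symm)
  obtain ⟨e⟩ := addEquiv_of_surj f g (Submodule.mkQ_surjective _) (fun α => by
      obtain ⟨φ, hφ, rfl⟩ := P.extMk_surjective α (n+2) rfl
      exact ⟨⟨φ, hφ⟩, rfl⟩) (fun z => by
      refine Iff.trans ?_ (P.extMk_eq_zero_iff (z.1 : P.complex.X (n+1) ⟶ Y) (n+2) rfl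
        (hZ z) n rfl).symm
      refine (Submodule.Quotient.mk_eq_zero _).trans ?_
      constructor
      · rintro ⟨y, rfl⟩
        exact ⟨y, rfl⟩
      · rintro ⟨y, hy⟩
        exact ⟨y, Subtype.ext hy⟩)
  exact ⟨e1.trans e⟩

theorem bridge_zero {R : Type} [CommRing R] (X Y : ModuleCat.{0} R)
    (h : Subsingleton (X ⟶ Y)) : Subsingleton (((Ext R (ModuleCat R) 0).obj (op X)).obj Y) := by
  let P := projectiveResolution X
  let T := P.complex.linearYonedaObj R Y
  suffices IsZero (T.homology 0) from
    ModuleCat.subsingleton_of_isZero (this.of_iso (P.isoExt (R := R) 0 Y))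
  rw [← HomologicalComplex.exactAt_iff_isZero_homology,
    HomologicalComplex.exactAt_iff' T 0 0 1 (by simp) (by simp), ShortComplex.moduleCat_exact_iff]
  intro f hf
  have hf' : P.complex.d 1 0 ≫ (f : P.complex.X 0 ⟶ Y) = 0 := hf
  refine ⟨0, ?_⟩
  have h0 : (f : P.complex.X 0 ⟶ Y) = 0 := by
    have hep : Epi (ShortComplex.mk _ _ P.complex_d_comp_π_f_zero).g :=
      inferInstanceAs (Epi (P.π.f 0))
    have hd := P.exact₀.g_desc (f : P.complex.X 0 ⟶ Y) hf'
    have h1 : P.exact₀.desc (f : P.complex.X 0 ⟶ Y) hf' = 0 := Subsingleton.elim (α := X ⟶ Y) _ _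
    rw [← hd, h1, comp_zero]
    rfl
  rw [map_zero]
  exact h0.symm

theorem eSub {R : Type} [CommRing R] (X Y : ModuleCat.{0} R) (n : ℕ)
    (h : Subsingleton (Abelian.Ext.{0} X Y n)) :
    Subsingleton (((Ext R (ModuleCat R) n).obj (op X)).obj Y) := by
  cases n with
  | zero => exact bridge_zero X Y (Abelian.Ext.homEquiv₀.subsingleton_congr.mp h)
  | succ n => exact (bridge_succ X Y n).some.toEquiv.subsingleton_congr.mpr h

end

theorem padic_pid (p : ℕ) [Fact p.Prime] (K : Type) [Field K] [Algebra ℚ_[p] K]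
    [Algebra ℤ_[p] K] [IsScalarTower ℤ_[p] ℚ_[p] K] [FiniteDimensional ℚ_[p] K] :
    IsPrincipalIdealRing (PadicValRing p K) ∧ ¬ IsField (PadicValRing p K) := by
  have : CharZero K := charZero_of_injective_algebraMap (algebraMap ℚ_[p] K).injective
  have hD : IsDedekindDomain (PadicValRing p K) := integralClosure.isDedekindDomain ℤ_[p] ℚ_[p] K
  have hinjK : Function.Injective (algebraMap ℤ_[p] K) := by
    rw [IsScalarTower.algebraMap_eq ℤ_[p] ℚ_[p] K]
    exact (algebraMap ℚ_[p] K).injective.comp (IsFractionRing.injective ℤ_[p] ℚ_[p])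
  have hinj : Function.Injective (algebraMap ℤ_[p] (PadicValRing p K)) := by
    intro a b h
    exact hinjK (congrArg Subtype.val h)
  have hfaith : FaithfulSMul ℤ_[p] (PadicValRing p K) :=
    (faithfulSMul_iff_algebraMap_injective _ _).2 hinj
  have hint : Algebra.IsIntegral ℤ_[p] (PadicValRing p K) := inferInstance
  have : Module.IsTorsionFree ℤ_[p] (PadicValRing p K) := inferInstance
  constructor
  · apply IsPrincipalIdealRing.of_finite_primes
    have hf := IsDedekindDomain.primesOver_finite (IsLocalRing.maximalIdeal ℤ_[p]) (PadicValRing p K)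
    refine (hf.insert ⊥).subset ?_
    intro P hP
    by_cases h0 : P = ⊥
    · left; exact h0
    right
    have hP' : P.IsPrime := hP
    refine ⟨hP, ⟨?_⟩⟩
    have hm : P.IsMaximal := hP'.isMaximal h0
    have : (P.under ℤ_[p]).IsMaximal := Ideal.isMaximal_comap_of_isIntegral_of_isMaximal P
    exact (IsLocalRing.eq_maximalIdeal this).symm
  · intro hF
    have := isField_of_isIntegral_of_isField hinj hF
    exact IsDiscreteValuationRing.not_isField ℤ_[p] this

section
variable {R : Type} [CommRing R]

abbrev EE (R : Type) [CommRing R] (N : Type) [AddCommGroup N] [Module R N] (n : ℕ) : Type :=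
  Abelian.Ext.{0} (ModuleCat.of R N) (ModuleCat.of R R) n

structure Good (R : Type) [CommRing R] (N : Type) [AddCommGroup N] [Module R N] (n : ℕ) : Prop where
  sub : ∀ i, i ≠ n → Subsingleton (EE R N i)
  iso : Nonempty (EE R N n ≃ₗ[R] N)

open Abelian

variable {N N' : Type} [AddCommGroup N] [Module R N] [AddCommGroup N'] [Module R N']

theorem EE_congr (e : N ≃ₗ[R] N') (n : ℕ) : Nonempty (EE R N n ≃ₗ[R] EE R N' n) := by
  let f := e.toModuleIso
  refine ⟨LinearEquiv.ofLinearMap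
    ((Ext.bilinearCompOfLinear R _ _ _ 0 n n (zero_add n)) (Ext.mk₀ f.inv))
    ((Ext.bilinearCompOfLinear R _ _ _ 0 n n (zero_add n)) (Ext.mk₀ f.hom)) ?_ ?_⟩
  · ext x; simp
  · ext x; simp

theorem Good.congr {n : ℕ} (h : Good R N n) (e : N ≃ₗ[R] N') : Good R N' n := by
  refine ⟨fun i hi => ?_, ?_⟩
  · have := h.sub i hi
    exact (EE_congr e i).some.symm.injective.subsingleton
  · exact ⟨(EE_congr e n).some.symm.trans (h.iso.some.trans e)⟩

theorem Good.base : Good R R 0 := by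
  refine ⟨fun i hi => ?_, ?_⟩
  · obtain ⟨j, rfl⟩ := Nat.exists_eq_succ_of_ne_zero hi
    exact Ext.subsingleton_of_projective _ _ j
  · exact ⟨(Ext.linearEquiv₀ (R := R)).trans
      (ModuleCat.homLinearEquiv (S := R) |>.trans (LinearMap.ringLmapEquivSelf R R R))⟩

theorem Good.step {n : ℕ} (h : Good R N n) (x : R) (hx : ∀ y : N, x • y = 0 → y = 0)
    (g : N →ₗ[R] N') (hg : Function.Surjective g) (hk : ∀ y, g y = 0 ↔ ∃ z, x • z = y) :
    Good R N' (n + 1) := by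
  let S : ShortComplex (ModuleCat.{0} R) := ShortComplex.mk
    (X₁ := ModuleCat.of R N) (X₂ := ModuleCat.of R N) (X₃ := ModuleCat.of R N')
    (x • 𝟙 _) (ModuleCat.ofHom g) (by
      ext y
      exact (hk _).2 ⟨y, rfl⟩)
  have hS : S.ShortExact := by
    have h1 : S.Exact := by
      rw [ShortComplex.moduleCat_exact_iff]
      intro y hy
      exact (hk y).1 hy
    have h2 : Mono S.f := by
      rw [ModuleCat.mono_iff_injective]
      exact (injective_iff_map_eq_zero S.f.hom).2 hx
    have h3 : Epi S.g := by
      rw [ModuleCat.epi_iff_surjective]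
      exact hg
    exact ⟨h1⟩
  have hf : ∀ {i} (y : EE R N i), (Ext.mk₀ S.f).comp y (zero_add i) = x • y := by
    intro i y
    change (Ext.mk₀ (x • 𝟙 (ModuleCat.of R N))).comp y _ = _
    rw [Ext.mk₀_smul, Ext.smul_comp, Ext.mk₀_id_comp]
  obtain ⟨e⟩ := h.iso
  have hinj : ∀ i (y : EE R N i), x • y = 0 → y = 0 := by
    intro i y hy
    by_cases hi : i = n
    · subst hi
      apply e.injective
      rw [map_zero]
      apply hx
      rw [← map_smul, hy, map_zero]
    · have := h.sub i hi
      exact Subsingleton.elim _ _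
  have hg0 : ∀ i (y : EE R N' i), (Ext.mk₀ S.g).comp y (zero_add i) = 0 := by
    intro i y
    apply hinj
    rw [← hf, Ext.mk₀_comp_mk₀_assoc, S.zero, Ext.mk₀_zero, Ext.zero_comp]
  have hsurj : ∀ i (y : EE R N' (i+1)), ∃ z : EE R N i,
      hS.extClass.comp z (add_comm 1 i) = y := fun i y =>
    Ext.contravariant_sequence_exact₃ hS _ y (hg0 _ y) (add_comm 1 i)
  refine ⟨fun i hi => ?_, ?_⟩
  · refine subsingleton_of_forall_eq 0 fun y => ?_
    cases i with
    | zero =>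
      have : Epi S.g := hS.epi_g
      apply Ext.precomp_mk₀_injective_of_epi _ S.g
      rw [map_zero]
      exact hg0 0 y
    | succ i =>
      obtain ⟨z, rfl⟩ := hsurj i y
      have := h.sub i (by omega)
      rw [Subsingleton.elim z 0, Ext.comp_zero]
  · let δ : EE R N n →ₗ[R] EE R N' (n+1) :=
      Ext.bilinearCompOfLinear R _ _ _ 1 n (n+1) (add_comm 1 n) hS.extClass
    let φ : N →ₗ[R] EE R N' (n+1) := δ ∘ₗ e.symm.toLinearMap
    have hφ : Function.Surjective φ := by
      intro y
      obtain ⟨z, hz⟩ := hsurj n y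
      exact ⟨e z, (congrArg δ (e.symm_apply_apply z)).trans hz⟩
    have hker : LinearMap.ker φ = LinearMap.ker g := by
      ext y
      rw [LinearMap.mem_ker, LinearMap.mem_ker, hk]
      constructor
      · intro hy
        obtain ⟨w, hw⟩ := Ext.contravariant_sequence_exact₁ hS _ (e.symm y) (add_comm 1 n) hy
        refine ⟨e w, ?_⟩
        rw [← map_smul, ← hf, hw, e.apply_symm_apply]
      · rintro ⟨z, rfl⟩
        change hS.extClass.comp (e.symm (x • z)) (add_comm 1 n) = 0
        rw [map_smul, ← hf, ShortComplex.ShortExact.extClass_comp_assoc]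
    exact ⟨(φ.quotKerEquivOfSurjective hφ).symm.trans
      ((Submodule.quotEquivOfEq _ _ hker).trans (g.quotKerEquivOfSurjective hg))⟩

theorem Good.ideal_step {n : ℕ} {I : Ideal R} (h : Good R (R ⧸ I) n) (x : R)
    (hx : ∀ y, x * y ∈ I → y ∈ I) : Good R (R ⧸ (I ⊔ Ideal.span {x})) (n + 1) := by
  refine h.step x ?_ (Submodule.factor (le_sup_left : I ≤ I ⊔ Ideal.span {x}))
    (Submodule.factor_surjective _) ?_
  · intro y
    obtain ⟨y, rfl⟩ := Ideal.Quotient.mk_surjective y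
    intro hy
    rw [Ideal.Quotient.eq_zero_iff_mem]
    exact hx y (Ideal.Quotient.eq_zero_iff_mem.1 hy)
  · intro y
    obtain ⟨y, rfl⟩ := Ideal.Quotient.mk_surjective y
    refine Iff.trans (b := y ∈ I ⊔ Ideal.span {x}) (Ideal.Quotient.eq_zero_iff_mem) ?_
    rw [Submodule.mem_sup]
    constructor
    · rintro ⟨a, ha, b, hb, rfl⟩
      obtain ⟨c, rfl⟩ := Ideal.mem_span_singleton'.1 hb
      refine ⟨Ideal.Quotient.mk I c, ?_⟩
      change Ideal.Quotient.mk I (x * c) = _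
      rw [Ideal.Quotient.eq]
      have : x * c - (a + c * x) = -a := by ring
      rw [this]; exact I.neg_mem ha
    · rintro ⟨z, hz⟩
      obtain ⟨z, rfl⟩ := Ideal.Quotient.mk_surjective z
      have hz' : Ideal.Quotient.mk I (x * z) = Ideal.Quotient.mk I y := hz
      rw [Ideal.Quotient.eq] at hz'
      refine ⟨y - x * z, ?_, x * z, Ideal.mem_span_singleton'.2 ⟨z, mul_comm _ _⟩, by ring⟩
      rw [← neg_sub]; exact I.neg_mem hz'

theorem devissage (d : ℕ) (hR : ∀ P : Ideal R, P.IsMaximal → Good R (R ⧸ P) d) :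
    ∀ (c : ℕ) (M : Type) [AddCommGroup M] [Module R M] [Finite M], Nat.card M = c →
    (∀ i, i ≠ d → Subsingleton (EE R M i)) ∧ Finite (EE R M d) ∧
      Nat.card (EE R M d) = Nat.card M := by
  intro c
  induction c using Nat.strong_induction_on with
  | _ c ih =>
  intro M _ _ _ hc
  by_cases hM : Subsingleton M
  · have hz : Limits.IsZero (ModuleCat.of R M) := ModuleCat.isZero_of_subsingleton _
    have : Projective (ModuleCat.of R M) := hz.projective
    have hs : ∀ i, Subsingleton (EE R M i) := by
      intro i
      cases i with
      | zero =>
        refine Ext.homEquiv₀.subsingleton_congr.mpr ⟨fun a b => hz.eq_of_src a b⟩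
      | succ i => exact Ext.subsingleton_of_projective _ _ i
    have := hs d
    refine ⟨fun i _ => hs i, inferInstance, ?_⟩
    rw [Nat.card_unique, Nat.card_unique]
  · rw [not_subsingleton_iff_nontrivial] at hM
    have : Finite (Submodule R M) := Finite.of_injective _ SetLike.coe_injective
    obtain ⟨L, hL⟩ := IsAtomic.exists_atom (Submodule R M)
    have hs : IsSimpleModule R L := isSimpleModule_iff_isAtom.2 hL
    obtain ⟨P, hP, ⟨e⟩⟩ := isSimpleModule_iff_quot_maximal.1 hs
    have hG : Good R L d := (hR P hP).congr e.symm
    have hLn : Nontrivial L := IsSimpleModule.nontrivial R L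
    have hcard : Nat.card M = Nat.card L * Nat.card (M ⧸ L) :=
      Submodule.card_eq_card_quotient_mul_card L
    have hfq : Finite (M ⧸ L) := Finite.of_surjective _ L.mkQ_surjective
    have hlt : Nat.card (M ⧸ L) < c := by
      have h1 : 1 < Nat.card L := Finite.one_lt_card
      have h2 : 0 < Nat.card (M ⧸ L) := Nat.card_pos
      nlinarith
    obtain ⟨q1, q2, q3⟩ := ih _ hlt (M ⧸ L) rfl
    let S : ShortComplex (ModuleCat.{0} R) := ShortComplex.mk
      (ModuleCat.ofHom L.subtype) (ModuleCat.ofHom L.mkQ) (by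
        ext y
        exact (Submodule.Quotient.mk_eq_zero L).2 y.2)
    have hS : S.ShortExact := by
      have h1 : S.Exact := by
        rw [ShortComplex.moduleCat_exact_iff]
        intro y hy
        exact ⟨⟨y, (Submodule.Quotient.mk_eq_zero L).1 hy⟩, rfl⟩
      have h2 : Mono S.f := by
        rw [ModuleCat.mono_iff_injective]
        exact L.injective_subtype
      have h3 : Epi S.g := by
        rw [ModuleCat.epi_iff_surjective]
        exact L.mkQ_surjective
      exact ⟨h1⟩
    have hmid : ∀ i, i ≠ d → Subsingleton (EE R M i) := by
      intro i hi
      have a1 := hG.sub i hi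
      have a2 := q1 i hi
      refine subsingleton_of_forall_eq 0 fun y => ?_
      obtain ⟨z, rfl⟩ := Ext.contravariant_sequence_exact₂ hS _ y
        (Subsingleton.elim (α := EE R L i) _ _)
      rw [Subsingleton.elim (α := EE R (M ⧸ L) i) z 0, Ext.comp_zero]
    let α : EE R (M ⧸ L) d →+ EE R M d := (Ext.mk₀ S.g).precomp _ (zero_add d)
    let β : EE R M d →+ EE R L d := (Ext.mk₀ S.f).precomp _ (zero_add d)
    have hα : Function.Injective α := by
      rw [injective_iff_map_eq_zero]
      intro y hy
      cases d with
      | zero =>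
        have : Epi S.g := hS.epi_g
        apply Ext.precomp_mk₀_injective_of_epi _ S.g
        rw [map_zero]
        exact hy
      | succ k =>
        obtain ⟨z, rfl⟩ := Ext.contravariant_sequence_exact₃ hS _ y hy (add_comm 1 k)
        have := hG.sub k (by omega)
        rw [Subsingleton.elim (α := EE R L k) z 0, Ext.comp_zero]
    have hβ : Function.Surjective β := by
      intro y
      have := q1 (d+1) (by omega)
      exact Ext.contravariant_sequence_exact₁ hS _ y (add_comm 1 d)
        (Subsingleton.elim (α := EE R (M ⧸ L) (d+1)) _ _)
    have hαβ : β.ker = α.range := by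
      ext y
      constructor
      · intro hy
        exact Ext.contravariant_sequence_exact₂ hS _ y hy
      · rintro ⟨z, rfl⟩
        change (Ext.mk₀ S.f).comp ((Ext.mk₀ S.g).comp z (zero_add d)) (zero_add d) = 0
        rw [Ext.mk₀_comp_mk₀_assoc, S.zero, Ext.mk₀_zero, Ext.zero_comp]
    have hLc : Nat.card (EE R L d) = Nat.card L := Nat.card_congr hG.iso.some.toEquiv
    have hLf : Finite (EE R L d) := Finite.of_equiv _ hG.iso.some.toEquiv.symm
    have hk : Nat.card β.ker = Nat.card (M ⧸ L) := by
      rw [hαβ, ← q3]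
      exact Nat.card_congr (AddMonoidHom.ofInjective hα).toEquiv.symm
    have hq : Nat.card (EE R M d ⧸ β.ker) = Nat.card L := by
      rw [← hLc]
      exact Nat.card_congr (QuotientAddGroup.quotientKerEquivOfSurjective β hβ).toEquiv
    have htot : Nat.card (EE R M d) = Nat.card M := by
      rw [AddSubgroup.card_eq_card_quotient_mul_card_addSubgroup β.ker, hk, hq, hcard]
    refine ⟨hmid, ?_, htot⟩
    apply Nat.finite_of_card_ne_zero
    rw [htot]
    exact Nat.card_pos.ne'

end

section
open MvPowerSeries
variable {σ A : Type} [CommRing A] [DecidableEq σ]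

theorem mem_span_X (s : Finset σ) : ∀ f : MvPowerSeries σ A,
    f ∈ Ideal.span ((X : σ → MvPowerSeries σ A) '' (s : Set σ)) ↔
      ∀ m : σ →₀ ℕ, (∀ i ∈ s, m i = 0) → coeff m f = 0 := by
  induction s using Finset.induction_on with
  | empty =>
    intro f
    simp [MvPowerSeries.ext_iff]
  | insert j s hj ih =>
    intro f
    rw [Finset.coe_insert, Set.image_insert_eq, Ideal.span_insert, Submodule.mem_sup]
    constructor
    · rintro ⟨a, ha, b, hb, rfl⟩ m hm
      rw [map_add, (ih b).1 hb m (fun i hi => hm i (Finset.mem_insert_of_mem hi)),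
        X_dvd_iff.1 (Ideal.mem_span_singleton.1 ha) m (hm j (Finset.mem_insert_self _ _)), add_zero]
    · intro hf
      let h : MvPowerSeries σ A := fun m => if m j = 0 then coeff m f else 0
      have hh : ∀ m, coeff m h = if m j = 0 then coeff m f else 0 := fun m => rfl
      refine ⟨f - h, Ideal.mem_span_singleton.2 (X_dvd_iff.2 fun m hm => ?_), h, (ih h).2 ?_,
        sub_add_cancel _ _⟩
      · rw [map_sub, hh, if_pos hm, sub_self]
      · intro m hm
        rw [hh]
        split_ifs with h0
        · apply hf
          intro i hi
          rcases Finset.mem_insert.1 hi with rfl | hi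
          · exact h0
          · exact hm i hi
        · rfl

theorem X_regular (s : Finset σ) (j : σ) (hj : j ∉ s) (f : MvPowerSeries σ A)
    (hf : X j * f ∈ Ideal.span ((X : σ → MvPowerSeries σ A) '' (s : Set σ))) :
    f ∈ Ideal.span ((X : σ → MvPowerSeries σ A) '' (s : Set σ)) := by
  rw [mem_span_X] at hf ⊢
  intro m hm
  have := hf (Finsupp.single j 1 + m) (fun i hi => by
    have : j ≠ i := fun h => hj (h ▸ hi)
    simp [this, hm i hi])
  rw [X, coeff_add_monomial_mul, one_mul] at this
  exact this

theorem C_regular [Fintype σ] [IsDomain A] (a : A) (ha : a ≠ 0) (f : MvPowerSeries σ A)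
    (hf : C a * f ∈ Ideal.span ((X : σ → MvPowerSeries σ A) '' ((Finset.univ : Finset σ) : Set σ))) :
    f ∈ Ideal.span ((X : σ → MvPowerSeries σ A) '' ((Finset.univ : Finset σ) : Set σ)) := by
  rw [mem_span_X] at hf ⊢
  intro m hm
  have := hf m hm
  rw [coeff_C_mul] at this
  exact (mul_eq_zero.1 this).resolve_left ha

theorem maximal_form [Fintype σ] [IsDomain A] [IsPrincipalIdealRing A] (hA : ¬ IsField A)
    (P : Ideal (MvPowerSeries σ A)) (hP : P.IsMaximal) :
    ∃ a : A, a ≠ 0 ∧ P = Ideal.span ((X : σ → MvPowerSeries σ A) ''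
      ((Finset.univ : Finset σ) : Set σ)) ⊔ Ideal.span {C a} := by
  have hX : Ideal.span ((X : σ → MvPowerSeries σ A) '' ((Finset.univ : Finset σ) : Set σ)) ≤ P := by
    rw [Ideal.span_le]
    rintro _ ⟨i, -, rfl⟩
    have hj : (X i : MvPowerSeries σ A) ∈ Ideal.jacobson ⊥ := by
      rw [Ideal.mem_jacobson_bot]
      intro y
      rw [MvPowerSeries.isUnit_iff_constantCoeff]
      simp
    exact Ideal.mem_sInf.1 hj ⟨bot_le, hP⟩
  have hdec : ∀ f : MvPowerSeries σ A, f - C (constantCoeff f) ∈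
      Ideal.span ((X : σ → MvPowerSeries σ A) '' ((Finset.univ : Finset σ) : Set σ)) := by
    intro f
    rw [mem_span_X]
    intro m hm
    have : m = 0 := by ext i; exact hm i (Finset.mem_univ i)
    subst this
    simp
  obtain ⟨a, ha⟩ := (IsPrincipalIdealRing.principal (P.comap (C : A →+* MvPowerSeries σ A))).principal
  have hmem : ∀ b, C b ∈ P ↔ ∃ c, c * a = b := by
    intro b
    rw [← Ideal.mem_comap, ha]
    exact Ideal.mem_span_singleton'
  refine ⟨a, ?_, le_antisymm ?_ (sup_le hX ?_)⟩
  · rintro rfl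
    apply hA
    refine ⟨exists_pair_ne A, mul_comm, ?_⟩
    intro b hb
    have hnb : C b ∉ P := by
      rw [hmem]
      rintro ⟨c, hc⟩
      exact hb (by rw [← hc, mul_zero])
    obtain ⟨y, z, hz, h1⟩ := hP.exists_inv hnb
    refine ⟨constantCoeff y, ?_⟩
    have h2 : C (constantCoeff z) ∈ P := by
      have := P.sub_mem hz (hX (hdec z))
      simpa using this
    obtain ⟨c, hc⟩ := (hmem _).1 h2
    have h3 := congrArg constantCoeff h1
    rw [map_add, map_mul, ← hc, constantCoeff_C, mul_zero, add_zero, map_one] at h3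
    rw [mul_comm, h3]
  · intro f hf
    have h2 : C (constantCoeff f) ∈ P := by
      have := P.sub_mem hf (hX (hdec f))
      simpa using this
    obtain ⟨c, hc⟩ := (hmem _).1 h2
    refine Submodule.mem_sup.2 ⟨_, hdec f, C (constantCoeff f), ?_, sub_add_cancel _ _⟩
    rw [← hc, map_mul]
    exact Ideal.mem_span_singleton'.2 ⟨_, rfl⟩
  · rw [Ideal.span_singleton_le_iff_mem, hmem]
    exact ⟨1, one_mul a⟩
end

theorem good_span {σ A : Type} [CommRing A] [DecidableEq σ] (s : Finset σ) :
    Good (MvPowerSeries σ A) (MvPowerSeries σ A ⧸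
      Ideal.span ((MvPowerSeries.X : σ → MvPowerSeries σ A) '' (s : Set σ))) s.card := by
  induction s using Finset.induction_on with
  | empty =>
    refine Good.base.congr (Submodule.quotEquivOfEqBot _ ?_).symm
    simp
  | insert j s hj ih =>
    have h := ih.ideal_step (MvPowerSeries.X j) (X_regular s j hj)
    rw [Finset.card_insert_of_notMem hj]
    refine h.congr (Submodule.quotEquivOfEq _ _ ?_)
    rw [Finset.coe_insert, Set.image_insert_eq, Ideal.span_insert, sup_comm]

theorem good_maximal {σ A : Type} [CommRing A] [DecidableEq σ] [Fintype σ] [IsDomain A]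
    [IsPrincipalIdealRing A] (hA : ¬ IsField A)
    (P : Ideal (MvPowerSeries σ A)) (hP : P.IsMaximal) :
    Good (MvPowerSeries σ A) (MvPowerSeries σ A ⧸ P) (Fintype.card σ + 1) := by
  obtain ⟨a, ha, rfl⟩ := maximal_form hA P hP
  exact (good_span (A := A) (Finset.univ : Finset σ)).ideal_step (MvPowerSeries.C a)
    (C_regular a ha)

/-- If `M` is a `Λ`-module of finite cardinality, then
`Ext^i_Λ(M,Λ) = 0` for all `i ≠ r + 1`, and `Ext^{r+1}_Λ(M,Λ)` is a module of finite
cardinality equal to the cardinality of `M`. -/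
theorem statement10 (p : ℕ) [Fact p.Prime] (K : Type) [Field K] [Algebra ℚ_[p] K]
    [Algebra ℤ_[p] K] [IsScalarTower ℤ_[p] ℚ_[p] K] [FiniteDimensional ℚ_[p] K]
    (r : ℕ) (hr : 1 ≤ r) (M : Type) [AddCommGroup M] [Module (IwasawaAlgebra p K r) M]
    [Finite M] :
    (∀ i : ℕ, i ≠ r + 1 → Subsingleton (ExtGroup (IwasawaAlgebra p K r) i M
      (IwasawaAlgebra p K r))) ∧
    Finite (ExtGroup (IwasawaAlgebra p K r) (r + 1) M (IwasawaAlgebra p K r)) ∧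
    Nat.card (ExtGroup (IwasawaAlgebra p K r) (r + 1) M (IwasawaAlgebra p K r)) =
      Nat.card M := by
  obtain ⟨hpid, hnf⟩ := padic_pid p K
  have hmax : ∀ P : Ideal (IwasawaAlgebra p K r), P.IsMaximal →
      Good (IwasawaAlgebra p K r) (IwasawaAlgebra p K r ⧸ P) (r + 1) := by
    intro P hP
    have := good_maximal (σ := Fin r) hnf P hP
    rwa [Fintype.card_fin] at this
  obtain ⟨h1, h2, h3⟩ := devissage (r + 1) hmax _ M rfl
  obtain ⟨e⟩ := bridge_succ (ModuleCat.of (IwasawaAlgebra p K r) M)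
    (ModuleCat.of (IwasawaAlgebra p K r) (IwasawaAlgebra p K r)) r
  exact ⟨fun i hi => eSub _ _ i (h1 i hi), Finite.of_equiv _ e.toEquiv.symm,
    (Nat.card_congr e.toEquiv).trans h3⟩
end
end

section
/- Let M be a small Λ-module. Then the Iwasawa adjoint α(M) = Ext^r_Λ(M,Λ) has no nonzero Λ-submodule of finite cardinality. -/
open CategoryTheory Opposite

set_option maxHeartbeats 1000000
set_option synthInstance.maxHeartbeats 400000

noncomputable section

theorem aux_ext_vanish {R : Type} [CommRing R] (L : ModuleCat.{0} R) (rs : List R)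
    (hL : ∀ a ∈ rs, ∀ x : L, a • x = 0) :
    ∀ (N : ModuleCat.{0} R), RingTheory.Sequence.IsWeaklyRegular N rs →
      ∀ i < rs.length, ∀ x : Abelian.Ext L N i, x = 0 := by
  induction rs with
  | nil => intro N _ i hi; simp at hi
  | cons a rs ih =>
    intro N hN i hi x
    rw [RingTheory.Sequence.isWeaklyRegular_cons_iff] at hN
    obtain ⟨h1, h2⟩ := hN
    have hS := h1.smulShortComplex_shortExact
    have hz : a • 𝟙 L = 0 := by
      ext y
      exact hL a (by simp) y
    have hax : x.comp (Abelian.Ext.mk₀ (ModuleCat.smulShortComplex N a).f) (add_zero i) = 0 := by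
      rw [ModuleCat.smulShortComplex_f_eq_smul_id]
      have h3 : x.comp (Abelian.Ext.mk₀ (a • 𝟙 N)) (add_zero i) = a • x := by
        simp [Abelian.Ext.mk₀_smul]
      have h4 : (Abelian.Ext.mk₀ (a • 𝟙 L)).comp x (zero_add i) = a • x := by
        simp [Abelian.Ext.mk₀_smul]
      refine Eq.trans h3 ?_
      rw [← h4, hz, Abelian.Ext.mk₀_zero, Abelian.Ext.zero_comp]
      rfl
    cases i with
    | zero =>
      have := hS.mono_f
      apply Abelian.Ext.postcomp_mk₀_injective_of_mono L (ModuleCat.smulShortComplex N a).f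
      exact hax.trans (map_zero _).symm
    | succ i =>
      obtain ⟨z, hz⟩ := Abelian.Ext.covariant_sequence_exact₁ L hS x hax rfl
      rw [← hz, ih (fun b hb => hL b (by simp [hb])) (ModuleCat.of R (QuotSMulTop a N)) h2 i
        (by simpa using hi) z]
      exact Abelian.Ext.zero_comp _ _ _ _ _

theorem aux_ext_vanish_pow {R : Type} [CommRing R] (rs : List R) (N : ModuleCat.{0} R)
    (hN : RingTheory.Sequence.IsWeaklyRegular N rs) (n : ℕ) :
    ∀ (L : ModuleCat.{0} R), (∀ a ∈ (Ideal.ofList rs) ^ n, ∀ x : L, a • x = 0) →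
      ∀ i < rs.length, ∀ x : Abelian.Ext L N i, x = 0 := by
  induction n with
  | zero =>
    intro L hL i hi
    apply aux_ext_vanish L rs _ N hN i hi
    intro a _ x
    exact hL a (by simp) x
  | succ n ih =>
    intro L hL i hi x
    let Q : Submodule R L := (Ideal.ofList rs) ^ n • ⊤
    have hS := LinearMap.shortExact_shortComplexKer (f := Q.mkQ) (Submodule.mkQ_surjective _)
    have hker : LinearMap.ker Q.mkQ = Q := Submodule.ker_mkQ Q
    obtain ⟨z, hz⟩ := Abelian.Ext.contravariant_sequence_exact₂ hS N x (by
      apply aux_ext_vanish _ rs _ N hN i hi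
      rintro a ha ⟨y, hy⟩
      apply Subtype.ext
      change a • y = 0
      replace hy : y ∈ Q := hker ▸ hy
      refine Submodule.smul_induction_on hy ?_ ?_
      · intro b hb m _
        rw [smul_smul]
        refine hL _ ?_ m
        rw [pow_succ']
        exact Ideal.mul_mem_mul (Ideal.subset_span ha) hb
      · intro u v hu hv
        rw [smul_add, hu, hv, add_zero])
    rw [← hz, ih (ModuleCat.of R (L ⧸ Q)) ?_ i hi z]
    · simp
    · intro a ha y
      obtain ⟨y, rfl⟩ := Submodule.mkQ_surjective _ y
      rw [← map_smul]
      exact (Submodule.Quotient.mk_eq_zero Q).2 (Submodule.smul_mem_smul ha Submodule.mem_top)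

theorem aux_ext_regular {R : Type} [CommRing R] (rs : List R) (N : ModuleCat.{0} R)
    (hN : RingTheory.Sequence.IsWeaklyRegular N rs) (n : ℕ) (M : ModuleCat.{0} R) (y : R)
    (h : ∀ a ∈ (Ideal.ofList rs) ^ n, a ∈ Module.annihilator R M ⊔ Ideal.span {y})
    (i : ℕ) (hi : i + 1 < rs.length) (x : Abelian.Ext M N (i + 1)) (hx : y • x = 0) : x = 0 := by
  let f : M →ₗ[R] M := LinearMap.lsmul R M y
  have hS := LinearMap.shortExact_shortComplexKer (f := f.rangeRestrict) f.surjective_rangeRestrict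
  have hT := LinearMap.shortExact_shortComplexKer (f := (LinearMap.range f).mkQ)
    (Submodule.mkQ_surjective _)
  have hkill : ∀ a ∈ (Ideal.ofList rs) ^ n, ∃ c : R, ∀ m : M, a • m = (c * y) • m := by
    intro a ha
    obtain ⟨b, hb, c, hc, rfl⟩ := Submodule.mem_sup.1 (h a ha)
    obtain ⟨d, rfl⟩ := Ideal.mem_span_singleton'.1 hc
    refine ⟨d, fun m => ?_⟩
    rw [add_smul, Module.mem_annihilator.1 hb, zero_add]
  have hker : LinearMap.ker (LinearMap.range f).mkQ = LinearMap.range f := Submodule.ker_mkQ _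
  let e : LinearMap.range f →ₗ[R] LinearMap.ker (LinearMap.range f).mkQ :=
    Submodule.inclusion hker.ge
  let e' : LinearMap.ker (LinearMap.range f).mkQ →ₗ[R] LinearMap.range f :=
    Submodule.inclusion hker.le
  have hee : ModuleCat.ofHom e' ≫ ModuleCat.ofHom e = 𝟙 _ := rfl
  have hcomp : ModuleCat.ofHom f.rangeRestrict ≫ ModuleCat.ofHom e ≫
      ModuleCat.ofHom (LinearMap.ker (LinearMap.range f).mkQ).subtype = y • 𝟙 M := rfl
  have h0 : (Abelian.Ext.mk₀ (ModuleCat.ofHom f.rangeRestrict)).comp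
      ((Abelian.Ext.mk₀ (ModuleCat.ofHom e ≫
      ModuleCat.ofHom (LinearMap.ker (LinearMap.range f).mkQ).subtype)).comp x (zero_add _))
      (zero_add _) = 0 := by
    rw [Abelian.Ext.mk₀_comp_mk₀_assoc, hcomp]
    simpa [Abelian.Ext.mk₀_smul] using hx
  obtain ⟨z, hz⟩ := Abelian.Ext.contravariant_sequence_exact₃ hS N _ h0 (add_comm 1 i)
  rw [aux_ext_vanish_pow rs N hN n _ ?_ i (by omega) z] at hz
  · rw [Abelian.Ext.comp_zero] at hz
    have h1 : (Abelian.Ext.mk₀ (ModuleCat.ofHom (LinearMap.ker (LinearMap.range f).mkQ).subtype)).comp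
      x (zero_add _) = 0 := by
      have := congrArg (fun t => (Abelian.Ext.mk₀ (ModuleCat.ofHom e')).comp t (zero_add _)) hz
      simp only [Abelian.Ext.comp_zero] at this
      rw [Abelian.Ext.mk₀_comp_mk₀_assoc, reassoc_of% hee] at this
      exact this.symm
    obtain ⟨z, rfl⟩ := Abelian.Ext.contravariant_sequence_exact₂ hT N x h1
    rw [aux_ext_vanish_pow rs N hN n _ ?_ (i+1) (by omega) z]
    · simp
    · intro a ha t
      obtain ⟨t, rfl⟩ := Submodule.mkQ_surjective _ t
      obtain ⟨c, hc⟩ := hkill a ha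
      rw [← map_smul, hc]
      simp only [Submodule.mkQ_apply, Submodule.Quotient.mk_eq_zero]
      exact ⟨c • t, by simp [f, smul_smul, mul_comm]⟩
  · rintro a ha ⟨t, ht⟩
    obtain ⟨c, hc⟩ := hkill a ha
    apply Subtype.ext
    change a • t = 0
    have : y • t = 0 := congrArg Subtype.val (LinearMap.mem_ker.1 ht)
    rw [hc, mul_smul, this, smul_zero]

theorem aux_bridge {R : Type} [CommRing R] (M N : ModuleCat.{0} R) (i : ℕ) (y : R)
    (h : ∀ x : Abelian.Ext M N (i + 1), y • x = 0 → x = 0)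
    (x : ((Ext R (ModuleCat R) (i + 1)).obj (op M)).obj N) (hx : y • x = 0) : x = 0 := by
  let P := ProjectiveResolution.of M
  let e := P.isoExt (R := R) (i + 1) N
  let C := P.complex.linearYonedaObj R N
  suffices H : ∀ z : C.homology (i + 1), y • z = 0 → z = 0 by
    have := H (e.hom x) (by rw [← map_smul, hx, map_zero])
    have h2 := congrArg e.inv this
    simpa using h2
  intro z hz
  obtain ⟨w, rfl⟩ := (ModuleCat.epi_iff_surjective (C.homologyπ (i+1))).1 inferInstance z
  have key : ∀ w : C.cycles (i + 1), C.homologyπ (i + 1) w = 0 ↔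
      ∃ g : C.X i, C.d i (i+1) g = C.iCycles (i+1) w := by
    intro w
    let S := ShortComplex.mk (C.toCycles i (i+1)) (C.homologyπ (i+1)) (by simp)
    have hS : S.Exact := S.exact_of_g_is_cokernel (C.homologyIsCokernel i (i+1) (by simp))
    rw [ShortComplex.moduleCat_exact_iff] at hS
    have hic : ∀ g, C.iCycles (i+1) (C.toCycles i (i+1) g) = C.d i (i+1) g := by
      intro g
      rw [← C.toCycles_i i (i+1)]
      rfl
    constructor
    · intro hw
      obtain ⟨g, hg⟩ := hS w hw
      refine ⟨g, ?_⟩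
      rw [← hic]
      exact congrArg _ hg
    · rintro ⟨g, hg⟩
      rw [← hic] at hg
      rw [← (ModuleCat.mono_iff_injective (C.iCycles (i+1))).1 inferInstance hg]
      exact congrArg (fun t => t.hom g) S.zero
  have hcyc : ∀ w : C.cycles (i + 1), C.d (i+1) (i+2) (C.iCycles (i+1) w) = 0 := by
    intro w
    exact congrArg (fun t => t.hom w) (C.iCycles_d (i+1) (i+2))
  rw [← map_smul, key] at hz
  rw [key]
  obtain ⟨g, hg⟩ := hz
  let f : P.complex.X (i+1) ⟶ N := C.iCycles (i+1) w
  have hf : P.complex.d (i+2) (i+1) ≫ f = 0 := hcyc w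
  have := h (P.extMk f (i+2) rfl hf) (by
    rw [Abelian.Ext.smul_eq_comp_mk₀, P.extMk_comp_mk₀, P.extMk_eq_zero_iff _ _ _ _ i rfl]
    refine ⟨g, ?_⟩
    rw [map_smul] at hg
    refine Eq.trans hg ?_
    change y • f = _
    rw [Linear.comp_smul, Category.comp_id])
  rw [P.extMk_eq_zero_iff _ _ _ _ i rfl] at this
  obtain ⟨g, hg⟩ := this
  exact ⟨g, hg⟩

theorem aux_mem_ofList {r : ℕ} {A : Type} [CommRing A] (l : List (Fin r)) :
    ∀ f : MvPowerSeries (Fin r) A,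
    f ∈ Ideal.ofList (l.map (MvPowerSeries.X (R := A))) ↔
      ∀ n : Fin r →₀ ℕ, (∀ j ∈ l, n j = 0) → MvPowerSeries.coeff n f = 0 := by
  classical
  induction l with
  | nil =>
    intro f
    simp [MvPowerSeries.ext_iff]
  | cons a l ih =>
    intro f
    rw [List.map_cons, Ideal.ofList_cons, Submodule.mem_sup]
    constructor
    · rintro ⟨u, hu, v, hv, rfl⟩ n hn
      rw [map_add, (ih v).1 hv n (fun j hj => hn j (by simp [hj])),
        MvPowerSeries.X_dvd_iff.1 (Ideal.mem_span_singleton.1 hu) n (hn a (by simp)), add_zero]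
    · intro h
      let u : MvPowerSeries (Fin r) A := fun n => if n a = 0 then 0 else MvPowerSeries.coeff n f
      have hu : ∀ n, MvPowerSeries.coeff n u = if n a = 0 then 0 else MvPowerSeries.coeff n f :=
        fun n => rfl
      refine ⟨u, ?_, f - u, ?_, by ring⟩
      · rw [Ideal.mem_span_singleton, MvPowerSeries.X_dvd_iff]
        intro m hm
        rw [hu, if_pos hm]
      · rw [ih]
        intro n hn
        rw [map_sub, hu]
        split_ifs with h0
        · rw [sub_zero]
          apply h
          intro j hj
          rcases List.mem_cons.1 hj with rfl | hj
          · exact h0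
          · exact hn j hj
        · rw [sub_self]

theorem aux_regular_quot {R : Type} [CommRing R] (I : Ideal R) (a : R)
    (h : ∀ f, a * f ∈ I → f ∈ I) : IsSMulRegular (R ⧸ (I • ⊤ : Submodule R R)) a := by
  rw [isSMulRegular_iff_right_eq_zero_of_smul]
  intro x hx
  obtain ⟨f, rfl⟩ := Submodule.mkQ_surjective _ x
  rw [← map_smul, Submodule.mkQ_apply, Submodule.Quotient.mk_eq_zero] at hx
  rw [Submodule.mkQ_apply, Submodule.Quotient.mk_eq_zero]
  simp only [smul_eq_mul, Ideal.mul_top] at hx ⊢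
  exact h f hx

theorem aux_regular_vars {r : ℕ} {A : Type} [CommRing A] (l : List (Fin r)) (hl : l.Nodup) :
    RingTheory.Sequence.IsWeaklyRegular (MvPowerSeries (Fin r) A)
      (l.map (MvPowerSeries.X (R := A))) := by
  induction l using List.reverseRecOn with
  | nil => exact RingTheory.Sequence.IsWeaklyRegular.nil _ _
  | append_singleton l a ih =>
    rw [List.map_append, RingTheory.Sequence.isWeaklyRegular_append_iff]
    refine ⟨ih (List.nodup_append.1 hl).1, ?_⟩
    rw [List.map_singleton, RingTheory.Sequence.isWeaklyRegular_singleton_iff]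
    apply aux_regular_quot
    intro f hf
    rw [aux_mem_ofList] at hf ⊢
    intro n hn
    have := hf (n + Finsupp.single a 1) (by
      intro j hj
      have : a ≠ j := by
        rintro rfl
        simp [List.nodup_append] at hl
        exact hl.2 _ hj rfl
      simp [hn j hj, this])
    rwa [mul_comm, MvPowerSeries.X, MvPowerSeries.coeff_add_mul_monomial, mul_one] at this

/-- The sequence `t₁, …, t_r, p`. -/
def auxSeq (r : ℕ) (A : Type) [CommRing A] (p : ℕ) : List (MvPowerSeries (Fin r) A) :=
  (List.finRange r).map MvPowerSeries.X ++ [MvPowerSeries.C (p : A)]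

theorem aux_mem_vars {r : ℕ} {A : Type} [CommRing A] (f : MvPowerSeries (Fin r) A) :
    f ∈ Ideal.ofList ((List.finRange r).map (MvPowerSeries.X (R := A))) ↔
      MvPowerSeries.constantCoeff f = 0 := by
  rw [aux_mem_ofList, ← MvPowerSeries.coeff_zero_eq_constantCoeff_apply]
  constructor
  · intro h
    exact h 0 (by simp)
  · intro h n hn
    have : n = 0 := by
      ext j
      exact hn j (by simp)
    rw [this, h]

theorem auxSeq_regular (r : ℕ) (A : Type) [CommRing A] [IsDomain A] (p : ℕ) (hp : (p : A) ≠ 0) :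
    RingTheory.Sequence.IsWeaklyRegular (MvPowerSeries (Fin r) A) (auxSeq r A p) := by
  rw [auxSeq, RingTheory.Sequence.isWeaklyRegular_append_iff,
    RingTheory.Sequence.isWeaklyRegular_singleton_iff]
  refine ⟨aux_regular_vars _ (List.nodup_finRange r), ?_⟩
  apply aux_regular_quot
  intro f hf
  rw [aux_mem_vars] at hf ⊢
  rw [map_mul, MvPowerSeries.constantCoeff_C] at hf
  exact (mul_eq_zero.1 hf).resolve_left hp

theorem auxSeq_mem (r : ℕ) (A : Type) [CommRing A] (p : ℕ) (f : MvPowerSeries (Fin r) A) :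
    f ∈ Ideal.ofList (auxSeq r A p) ↔ MvPowerSeries.constantCoeff f ∈ Ideal.span {(p : A)} := by
  rw [auxSeq, Ideal.ofList_append, Ideal.ofList_singleton, Submodule.mem_sup,
    Ideal.mem_span_singleton']
  constructor
  · rintro ⟨u, hu, v, hv, rfl⟩
    obtain ⟨w, rfl⟩ := Ideal.mem_span_singleton'.1 hv
    rw [aux_mem_vars] at hu
    exact ⟨MvPowerSeries.constantCoeff w, by simp [hu]⟩
  · rintro ⟨a, ha⟩
    refine ⟨f - MvPowerSeries.C (a * p), ?_, MvPowerSeries.C (a * p), ?_, by ring⟩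
    · rw [aux_mem_vars]
      simp [ha]
    · rw [map_mul]
      exact Ideal.mul_mem_left _ _ (Ideal.mem_span_singleton_self _)

/-- General commutative algebra: choosing the element `y`. -/
theorem aux_choose {R : Type} [CommRing R] [IsNoetherianRing R] (rs : List R) (I : Ideal R)
    (r : ℕ) (hlen : rs.length = r + 1)
    (hmax : ∀ P : Ideal R, P.IsPrime → Ideal.ofList rs ≤ P → P.IsMaximal)
    (hjac : ∀ P : Ideal R, P.IsMaximal → Ideal.ofList rs ≤ P)
    (hI : (r : ℕ∞) ≤ idealHeight I) :
    ∃ y ∈ Ideal.ofList rs, ∃ n : ℕ, (Ideal.ofList rs) ^ n ≤ I ⊔ Ideal.span {y} := by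
  classical
  -- maximal ideals have height at most r + 1
  have hht : ∀ P : Ideal R, P.IsMaximal → P.height ≤ (r + 1 : ℕ) := by
    intro P hP
    have h1 : P ∈ (Ideal.span (rs.toFinset : Set R)).minimalPrimes := by
      have : Ideal.span (rs.toFinset : Set R) = Ideal.ofList rs := by
        simp [Ideal.ofList]
      rw [this]
      refine ⟨⟨hP.isPrime, hjac P hP⟩, ?_⟩
      rintro Q ⟨hQ, hQ'⟩ hle
      exact ((hmax Q hQ hQ').eq_of_le hP.ne_top hle).ge
    refine (Ideal.height_le_card_of_mem_minimalPrimes_span_finset h1).trans ?_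
    rw [← hlen]
    exact_mod_cast List.toFinset_card_le rs
  have hr : ∀ P : PrimeSpectrum R, I ≤ P.asIdeal → (r : ℕ∞) ≤ Order.height P := fun P hP =>
    hI.trans (iInf_le (fun P : {P : PrimeSpectrum R // I ≤ P.asIdeal} => Order.height P.1) ⟨P, hP⟩)
  -- non-maximal primes over `I` are minimal
  have hmin : ∀ P : Ideal R, P.IsPrime → I ≤ P → ¬ P.IsMaximal → P ∈ I.minimalPrimes := by
    intro P hP hIP hPm
    refine ⟨⟨hP, hIP⟩, ?_⟩
    rintro Q ⟨hQ, hIQ⟩ hle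
    by_contra hne
    obtain ⟨m, hm, hPmle⟩ := P.exists_le_maximal hP.ne_top
    have hlt : P < m := lt_of_le_of_ne hPmle (by rintro rfl; exact hPm hm)
    have hQP : (⟨Q, hQ⟩ : PrimeSpectrum R) < ⟨P, hP⟩ := lt_of_le_not_ge hle hne
    have hPM : (⟨P, hP⟩ : PrimeSpectrum R) < ⟨m, hm.isPrime⟩ := hlt
    have a1 := hr ⟨Q, hQ⟩ hIQ
    have a2 := Order.height_add_one_le hQP
    have a3 := Order.height_add_one_le hPM
    have a4 := hht m hm
    rw [PrimeSpectrum.height_eq_orderHeight ⟨m, hm.isPrime⟩] at a4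
    have : ((r + 2 : ℕ) : ℕ∞) ≤ (r + 1 : ℕ) := by
      refine le_trans ?_ (a3.trans a4)
      calc ((r + 2 : ℕ) : ℕ∞) = r + 1 + 1 := by push_cast; rfl
        _ ≤ _ := by gcongr; exact (by gcongr : (r : ℕ∞) + 1 ≤ _).trans a2
    have := ENat.natCast_le_natCast.1 this
    omega
  have hfin : {P ∈ I.minimalPrimes | ¬ P.IsMaximal}.Finite :=
    (I.finite_minimalPrimes_of_isNoetherianRing).subset (fun _ h => h.1)
  obtain ⟨y, hy, hy'⟩ : ∃ y ∈ Ideal.ofList rs, ∀ P ∈ I.minimalPrimes, ¬ P.IsMaximal → y ∉ P := by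
    by_contra! hcon
    have := (Ideal.subset_union_prime_finite hfin (f := id) 0 0
      (fun P h _ _ => h.1.1.1) (I := Ideal.ofList rs)).1 (by
        intro y hy
        obtain ⟨P, h1, h2, h3⟩ := hcon y hy
        exact Set.mem_biUnion (⟨h1, h2⟩ : P ∈ {P ∈ I.minimalPrimes | ¬ P.IsMaximal}) h3)
    obtain ⟨P, hP, hle⟩ := this
    exact hP.2 (hmax P hP.1.1.1 hle)
  refine ⟨y, hy, ?_⟩
  have hrad : Ideal.ofList rs ≤ (I ⊔ Ideal.span {y}).radical := by
    rw [Ideal.radical_eq_sInf]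
    refine le_sInf ?_
    rintro P ⟨hle, hP⟩
    apply hjac
    by_contra hPm
    have hIP := le_sup_left.trans hle
    refine hy' P (hmin P hP hIP hPm) hPm (hle (Ideal.mem_sup_right (Ideal.mem_span_singleton_self _)))
  exact Ideal.exists_pow_le_of_le_radical_of_fg hrad (IsNoetherian.noetherian _)

theorem aux_max (r : ℕ) (A : Type) [CommRing A] (p : ℕ)
    (hA : ∀ P : Ideal A, P.IsPrime → (p : A) ∈ P → P.IsMaximal)
    (P : Ideal (MvPowerSeries (Fin r) A)) (hP : P.IsPrime)
    (h : Ideal.ofList (auxSeq r A p) ≤ P) : P.IsMaximal := by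
  have hsurj : Function.Surjective (MvPowerSeries.constantCoeff (σ := Fin r) (R := A)) :=
    fun a => ⟨MvPowerSeries.C a, by simp⟩
  have hker : RingHom.ker (MvPowerSeries.constantCoeff (σ := Fin r) (R := A)) ≤ P := by
    intro f hf
    apply h
    rw [auxSeq_mem, RingHom.mem_ker.1 hf]
    exact zero_mem _
  have h1 := Ideal.map_isPrime_of_surjective hsurj hker
  have h2 := hA _ h1 (by
    have : MvPowerSeries.C (p : A) ∈ P := h (by rw [auxSeq_mem]; simp)
    simpa using Ideal.mem_map_of_mem (MvPowerSeries.constantCoeff (σ := Fin r) (R := A)) this)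
  have h3 := Ideal.comap_isMaximal_of_surjective _ hsurj (K := P.map MvPowerSeries.constantCoeff)
  rwa [Ideal.comap_map_of_surjective' _ hsurj, sup_eq_left.2 hker] at h3

theorem aux_jac (r : ℕ) (A : Type) [CommRing A] (p : ℕ)
    (hA : (p : A) ∈ Ideal.jacobson (⊥ : Ideal A)) :
    Ideal.ofList (auxSeq r A p) ≤ Ideal.jacobson ⊥ := by
  intro f hf
  rw [auxSeq_mem] at hf
  have hf' := (Ideal.span_singleton_le_iff_mem _).2 hA hf
  rw [Ideal.mem_jacobson_bot] at hf' ⊢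
  intro g
  rw [MvPowerSeries.isUnit_iff_constantCoeff]
  simpa using hf' (MvPowerSeries.constantCoeff g)

theorem aux_O_jac (p : ℕ) [Fact p.Prime] (K : Type) [Field K] [Algebra ℚ_[p] K]
    [Algebra ℤ_[p] K] [IsScalarTower ℤ_[p] ℚ_[p] K] :
    (p : PadicValRing p K) ∈ Ideal.jacobson (⊥ : Ideal (PadicValRing p K)) := by
  rw [Ideal.jacobson, Ideal.mem_sInf]
  rintro P ⟨-, hP⟩
  have h1 := Ideal.isMaximal_comap_of_isIntegral_of_isMaximal (R := ℤ_[p]) P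
  have h2 : (p : ℤ_[p]) ∈ P.comap (algebraMap ℤ_[p] (PadicValRing p K)) := by
    rw [IsLocalRing.eq_maximalIdeal h1, PadicInt.maximalIdeal_eq_span_p]
    exact Ideal.mem_span_singleton_self _
  simpa using h2

theorem aux_O (p : ℕ) [Fact p.Prime] (K : Type) [Field K] [Algebra ℚ_[p] K]
    [Algebra ℤ_[p] K] [IsScalarTower ℤ_[p] ℚ_[p] K] [FiniteDimensional ℚ_[p] K] :
    IsDedekindDomain (PadicValRing p K) ∧ (p : PadicValRing p K) ≠ 0 := by
  have : CharZero K := charZero_of_injective_algebraMap (algebraMap ℚ_[p] K).injective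
  refine ⟨integralClosure.isDedekindDomain ℤ_[p] ℚ_[p] K, ?_⟩
  intro h
  have := congrArg Subtype.val h
  simp at this
  exact (Fact.out : p.Prime).ne_zero this

theorem aux_finite {R : Type} [CommRing R] {E : Type} [AddCommGroup E] [Module R E] (y : R)
    (hy : y ∈ Ideal.jacobson (⊥ : Ideal R)) (hreg : ∀ x : E, y • x = 0 → x = 0)
    (N : Submodule R E) (hN : Set.Finite (N : Set E)) : N = ⊥ := by
  have hfin : Finite N := hN
  have hsurj : Function.Surjective (fun x : N => y • x) := by
    apply Finite.surjective_of_injective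
    intro a b hab
    have h1 : y • ((a : E) - b) = 0 := by
      rw [smul_sub, sub_eq_zero]
      exact congrArg Subtype.val hab
    exact Subtype.ext (sub_eq_zero.1 (hreg _ h1))
  have hfg : N.FG := Module.Finite.iff_fg.1 inferInstance
  refine Submodule.eq_bot_of_le_smul_of_le_jacobson_bot (Ideal.span {y}) N hfg ?_
    ((Ideal.span_singleton_le_iff_mem _).2 hy)
  intro x hx
  obtain ⟨z, hz⟩ := hsurj ⟨x, hx⟩
  have : y • (z : E) = x := congrArg Subtype.val hz
  rw [← this]
  exact Submodule.smul_mem_smul (Ideal.mem_span_singleton_self _) z.2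

theorem aux_final {R : Type} [CommRing R] (rs : List R)
    (hreg' : RingTheory.Sequence.IsWeaklyRegular R rs) (M : Type) [AddCommGroup M] [Module R M]
    (i : ℕ) (hlen : i + 1 < rs.length) (n : ℕ) (y : R)
    (hn : (Ideal.ofList rs) ^ n ≤ Module.annihilator R M ⊔ Ideal.span {y})
    (hy : y ∈ Ideal.jacobson (⊥ : Ideal R)) :
    ∀ N : Submodule R (ExtGroup R (i + 1) M R),
      Set.Finite (N : Set (ExtGroup R (i + 1) M R)) → N = ⊥ := by
  have h1 := aux_ext_regular rs (ModuleCat.of R R) hreg' n (ModuleCat.of R M) y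
    (fun a ha => hn ha) i hlen
  have hreg := aux_bridge (ModuleCat.of R M) (ModuleCat.of R R) i y h1
  exact fun N hN => aux_finite y hy hreg N hN

theorem statement11 (p : ℕ) [Fact p.Prime] (K : Type) [Field K] [Algebra ℚ_[p] K]
    [Algebra ℤ_[p] K] [IsScalarTower ℤ_[p] ℚ_[p] K] [FiniteDimensional ℚ_[p] K]
    (r : ℕ) (hr : 1 ≤ r) (M : Type) [AddCommGroup M] [Module (IwasawaAlgebra p K r) M]
    [Module.Finite (IwasawaAlgebra p K r) M]
    (hsmall : (r : ℕ∞) ≤ idealHeight (Module.annihilator (IwasawaAlgebra p K r) M)) :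
    ∀ N : Submodule (IwasawaAlgebra p K r)
        (ExtGroup (IwasawaAlgebra p K r) r M (IwasawaAlgebra p K r)),
      Set.Finite (N : Set (ExtGroup (IwasawaAlgebra p K r) r M (IwasawaAlgebra p K r))) →
        N = ⊥ := by
  obtain ⟨hD, hp0⟩ := aux_O p K
  have hjac := aux_jac r (PadicValRing p K) p (aux_O_jac p K)
  have hlen : (auxSeq r (PadicValRing p K) p).length = r + 1 := by simp [auxSeq]
  obtain ⟨y, hy, n, hn⟩ := aux_choose (auxSeq r (PadicValRing p K) p)
    (Module.annihilator (IwasawaAlgebra p K r) M) r hlen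
    (aux_max r _ p (fun P hP hpP => hP.isMaximal (by rintro rfl; exact hp0 hpP)))
    (fun P hP => hjac.trans (sInf_le ⟨bot_le, hP⟩)) hsmall
  obtain ⟨i, rfl⟩ : ∃ i, r = i + 1 := ⟨r - 1, by omega⟩
  exact aux_final (R := MvPowerSeries (Fin (i + 1)) (PadicValRing p K))
    _ (auxSeq_regular (i + 1) (PadicValRing p K) p hp0) M i (by omega) n y hn (hjac hy)
end
end

section
/- Let M be a small Λ-module and let f ∈ Λ be a non-unit that is not contained in any height-r prime ideal of Λ containing Ann_Λ(M). Then for every n ≥ 1 the quotient M/fⁿM and the f-power torsion submodule M[fⁿ] = {m ∈ M : fⁿm = 0} are modules of finite cardinality. -/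
open CategoryTheory Opposite

set_option maxHeartbeats 1000000
set_option synthInstance.maxHeartbeats 400000

noncomputable section

lemma aux_finite_module {A : Type} [CommRing A] [IsNoetherianRing A] (N : Type) [AddCommGroup N]
    [Module A N] [hN : Module.Finite A N]
    (h : ∀ P : Ideal A, P.IsPrime → Module.annihilator A N ≤ P → Finite (A ⧸ P)) : Finite N := by
  induction hN using IsNoetherianRing.induction_on_isQuotientEquivQuotientPrime A with
  | subsingleton N => infer_instance
  | quotient N p e =>
    have : Finite (A ⧸ p.1) := h p.1 p.2 (by
      rw [e.annihilator_eq, Ideal.annihilator_quotient])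
    exact Finite.of_equiv _ e.symm.toEquiv
  | exact N₁ N₂ N₃ f g hf hg hfg h₁ h₃ =>
    have f1 : Finite N₁ := h₁ fun P hP hle => h P hP ((f.annihilator_le_of_injective hf).trans hle)
    have f3 : Finite N₃ := h₃ fun P hP hle => h P hP ((g.annihilator_le_of_surjective hg).trans hle)
    have e := (g.quotKerEquivOfSurjective hg).toEquiv
    have : Finite (N₂ ⧸ LinearMap.ker g) := Finite.of_equiv _ e.symm
    have hk : LinearMap.ker g = LinearMap.range f := hfg.linearMap_ker_eq
    have : Finite (LinearMap.ker g) := by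
      rw [hk]
      exact Finite.of_surjective _ f.surjective_rangeRestrict
    have : Finite (N₂ ⧸ (LinearMap.ker g).toAddSubgroup) :=
      inferInstanceAs (Finite (N₂ ⧸ LinearMap.ker g))
    have : Finite (LinearMap.ker g).toAddSubgroup := inferInstanceAs (Finite (LinearMap.ker g))
    exact Finite.of_equiv _
      (AddSubgroup.addGroupEquivQuotientProdAddSubgroup (s := (LinearMap.ker g).toAddSubgroup)).symm

lemma aux_mem_jacobson {σ R : Type} [CommRing R] (x : MvPowerSeries σ R)
    (hx : MvPowerSeries.constantCoeff x = 0) : x ∈ Ring.jacobson (MvPowerSeries σ R) := by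
  rw [← Ideal.jacobson_bot, Ideal.mem_jacobson_bot]
  intro y
  rw [MvPowerSeries.isUnit_iff_constantCoeff]
  simp [hx]

lemma aux_dim_ps (R : Type) [CommRing R] [IsNoetherianRing R] :
    ringKrullDim (PowerSeries R) ≤ ringKrullDim R + 1 := by
  have hX : (PowerSeries.X : PowerSeries R) ∈ Ring.jacobson (PowerSeries R) :=
    aux_mem_jacobson (σ := Unit) _ (MvPowerSeries.constantCoeff_X (R := R) ())
  have h := ringKrullDim_le_ringKrullDim_quotient_add_card
    ({PowerSeries.X} : Finset (PowerSeries R)) (by simpa using hX)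
  refine h.trans ?_
  rw [Finset.coe_singleton, Finset.card_singleton, Nat.cast_one]
  gcongr
  refine ringKrullDim_le_of_surjective
    ((Ideal.Quotient.mk (Ideal.span {(PowerSeries.X : PowerSeries R)})).comp PowerSeries.C) ?_
  intro y
  obtain ⟨y, rfl⟩ := Ideal.Quotient.mk_surjective y
  refine ⟨PowerSeries.constantCoeff y, ?_⟩
  rw [RingHom.comp_apply, Ideal.Quotient.eq, Ideal.mem_span_singleton, PowerSeries.X_dvd_iff]
  simp

lemma aux_dim_mv (R : Type) [CommRing R] [IsNoetherianRing R] (r : ℕ) :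
    ringKrullDim (MvPowerSeries (Fin r) R) ≤ ringKrullDim R + r := by
  induction r with
  | zero =>
    rw [ringKrullDim_eq_of_ringEquiv (MvPowerSeries.isEmptyEquiv (σ := Fin 0) (R := R)).toRingEquiv]
    simp
  | succ n ih =>
    rw [ringKrullDim_eq_of_ringEquiv (MvPowerSeries.finSuccEquiv (n := n) (R := R)).toRingEquiv]
    refine (aux_dim_ps _).trans ?_
    push_cast
    rw [← add_assoc]
    gcongr

lemma aux_general (A : Type) [CommRing A] [IsNoetherianRing A] (r : ℕ)
    (hdim : ringKrullDim A ≤ ((r + 1 : ℕ) : ℕ∞))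
    (hres : ∀ P : Ideal A, P.IsMaximal → Finite (A ⧸ P))
    (M : Type) [AddCommGroup M] [Module A M] [Module.Finite A M]
    (hsmall : (r : ℕ∞) ≤ idealHeight (Module.annihilator A M)) (f : A)
    (hfP : ∀ P : PrimeSpectrum A, Module.annihilator A M ≤ P.asIdeal →
      Order.height P = (r : ℕ∞) → f ∉ P.asIdeal) :
    ∀ n : ℕ, 1 ≤ n →
      Finite (M ⧸ LinearMap.range ((f ^ n) • (LinearMap.id : M →ₗ[A] M))) ∧
      Finite ↥(LinearMap.ker ((f ^ n) • (LinearMap.id : M →ₗ[A] M))) := by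
  have key : ∀ P : Ideal (A), P.IsPrime →
      Module.annihilator (A) M ≤ P → f ∈ P →
      Finite (A ⧸ P) := by
    intro P hP hle hfm
    apply hres
    let P' : PrimeSpectrum (A) := ⟨P, hP⟩
    have h1 : (r : ℕ∞) ≤ Order.height P' := by
      refine hsmall.trans ?_
      unfold idealHeight
      exact iInf_le (fun Q : {Q : PrimeSpectrum A // Module.annihilator A M ≤ Q.asIdeal} =>
        Order.height Q.1) ⟨P', hle⟩
    have h2 : Order.height P' ≠ (r : ℕ∞) := fun h => hfP P' hle h hfm
    have h3 : (r : ℕ∞) + 1 ≤ Order.height P' :=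
      Order.add_one_le_of_lt (lt_of_le_of_ne h1 h2.symm)
    obtain ⟨Q, hQ, hPQ⟩ := P.exists_le_maximal hP.ne_top
    rcases eq_or_lt_of_le hPQ with h | h
    · rw [h]; exact hQ
    exfalso
    let Q' : PrimeSpectrum (A) := ⟨Q, hQ.isPrime⟩
    have h4 : Order.height P' + 1 ≤ Order.height Q' := Order.height_add_one_le (show P' < Q' from h)
    have h5 : Order.height Q' ≤ ((r + 1 : ℕ) : ℕ∞) := by
      have := (Order.height_le_krullDim Q').trans hdim
      exact_mod_cast this
    have h6 := ((add_le_add_left h3 1).trans h4).trans h5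
    norm_cast at h6
    omega
  intro n hn
  have hpow : ∀ P : Ideal (A), P.IsPrime → f ^ n ∈ P → f ∈ P :=
    fun P hP h => hP.mem_of_pow_mem n h
  constructor
  · apply aux_finite_module (A := A)
    intro P hP hle
    refine key P hP (le_trans ?_ hle) (hpow P hP (hle ?_))
    · exact LinearMap.annihilator_le_of_surjective _ (Submodule.mkQ_surjective _)
    · rw [Module.mem_annihilator]
      intro m
      obtain ⟨m, rfl⟩ := Submodule.mkQ_surjective _ m
      rw [← map_smul, Submodule.mkQ_apply, Submodule.Quotient.mk_eq_zero]
      exact ⟨m, rfl⟩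
  · apply aux_finite_module (A := A)
    intro P hP hle
    refine key P hP (le_trans ?_ hle) (hpow P hP (hle ?_))
    · exact LinearMap.annihilator_le_of_injective _ (Submodule.injective_subtype _)
    · rw [Module.mem_annihilator]
      rintro ⟨m, hm⟩
      exact Subtype.ext hm

section
variable (p : ℕ) [Fact p.Prime] (K : Type) [Field K] [Algebra ℚ_[p] K]
    [Algebra ℤ_[p] K] [IsScalarTower ℤ_[p] ℚ_[p] K] [FiniteDimensional ℚ_[p] K]

lemma aux_O_finite : Module.Finite ℤ_[p] (PadicValRing p K) :=
  IsIntegralClosure.finite ℤ_[p] ℚ_[p] K (PadicValRing p K)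

lemma aux_O_noeth : IsNoetherianRing (PadicValRing p K) :=
  have := aux_O_finite p K
  IsNoetherianRing.of_finite ℤ_[p] _

lemma aux_O_dim : ringKrullDim (PadicValRing p K) ≤ 1 := by
  have h : Ring.KrullDimLE 1 (PadicValRing p K) := by
    rw [Ring.krullDimLE_one_iff_of_noZeroDivisors]
    intro I hI hI'
    exact Ring.DimensionLEOne.maximalOfPrime hI hI'
  simpa [Ring.krullDimLE_iff] using h

lemma aux_O_residue (m : Ideal (PadicValRing p K)) (hm : m.IsMaximal) :
    Finite (PadicValRing p K ⧸ m) := by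
  have := aux_O_finite p K
  have hu : (m.under ℤ_[p]).IsMaximal := Ideal.isMaximal_comap_of_isIntegral_of_isMaximal m
  have hu' := IsLocalRing.eq_maximalIdeal hu
  have : Finite (ℤ_[p] ⧸ m.under ℤ_[p]) := by
    rw [hu']
    exact Finite.of_equiv (ZMod p) PadicInt.residueField.symm.toEquiv
  have : Module.Finite (ℤ_[p] ⧸ m.under ℤ_[p]) (PadicValRing p K ⧸ m) :=
    Module.Finite.of_restrictScalars_finite ℤ_[p] _ _
  exact Module.finite_of_finite (ℤ_[p] ⧸ m.under ℤ_[p])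

lemma aux_residue (r : ℕ) (P : Ideal (IwasawaAlgebra p K r)) (hP : P.IsMaximal) :
    Finite (IwasawaAlgebra p K r ⧸ P) := by
  let φ : PadicValRing p K →+* IwasawaAlgebra p K r ⧸ P :=
    (Ideal.Quotient.mk P).comp MvPowerSeries.C
  have hφ : Function.Surjective φ := by
    intro y
    obtain ⟨y, rfl⟩ := Ideal.Quotient.mk_surjective y
    refine ⟨MvPowerSeries.constantCoeff y, ?_⟩
    simp only [φ]
    rw [RingHom.comp_apply, Ideal.Quotient.eq]
    exact Ring.jacobson_le_of_isMaximal P (aux_mem_jacobson _ (by simp))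
  let := Ideal.Quotient.field P
  have hk : (RingHom.ker φ).IsMaximal := RingHom.ker_isMaximal_of_surjective φ hφ
  have := aux_O_residue p K _ hk
  exact Finite.of_equiv _ (RingHom.quotientKerEquivOfSurjective hφ).toEquiv
end

/-- Let `M` be a small `Λ`-module and let `f ∈ Λ` be a non-unit not
contained in any height-`r` prime ideal of `Λ` containing `Ann_Λ(M)`. Then for every
`n ≥ 1` the quotient `M/fⁿM` and the torsion submodule `M[fⁿ] = {m ∈ M | fⁿ m = 0}` are
of finite cardinality. -/
theorem statement12 (p : ℕ) [Fact p.Prime] (K : Type) [Field K] [Algebra ℚ_[p] K]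
    [Algebra ℤ_[p] K] [IsScalarTower ℤ_[p] ℚ_[p] K] [FiniteDimensional ℚ_[p] K]
    (r : ℕ) (hr : 1 ≤ r) (M : Type) [AddCommGroup M] [Module (IwasawaAlgebra p K r) M]
    [Module.Finite (IwasawaAlgebra p K r) M]
    (hsmall : (r : ℕ∞) ≤ idealHeight (Module.annihilator (IwasawaAlgebra p K r) M))
    (f : IwasawaAlgebra p K r) (hf : ¬ IsUnit f)
    (hfP : ∀ P : PrimeSpectrum (IwasawaAlgebra p K r),
      Module.annihilator (IwasawaAlgebra p K r) M ≤ P.asIdeal →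
      Order.height P = (r : ℕ∞) → f ∉ P.asIdeal) :
    ∀ n : ℕ, 1 ≤ n →
      Finite (M ⧸ LinearMap.range
        ((f ^ n) • (LinearMap.id : M →ₗ[IwasawaAlgebra p K r] M))) ∧
      Finite ↥(LinearMap.ker
        ((f ^ n) • (LinearMap.id : M →ₗ[IwasawaAlgebra p K r] M))) := by
  have := aux_O_noeth p K
  have hdim : ringKrullDim (IwasawaAlgebra p K r) ≤ ((r + 1 : ℕ) : ℕ∞) := by
    refine (aux_dim_mv _ r).trans ?_
    calc _ ≤ (1 : WithBot ℕ∞) + r := by gcongr; exact aux_O_dim p K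
      _ = _ := by push_cast; rw [add_comm]
  exact aux_general _ r hdim (aux_residue p K r) M hsmall f hfP
end
end

section
/- Let M be a small Λ-module and let P be a height-r prime ideal of Λ. Then the localizations M_P and (Ext^r_Λ(M,Λ))_P are Λ_P-modules of finite length, and length_{Λ_P}((Ext^r_Λ(M,Λ))_P) = length_{Λ_P}(M_P). Consequently the Iwasawa adjoint α(M) = Ext^r_Λ(M,Λ) and M have the same r-th localized Chern class, i.e., the same length at every height-r prime of Λ. -/
open CategoryTheory Opposite

set_option maxHeartbeats 1000000
set_option synthInstance.maxHeartbeats 400000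

noncomputable section

/-- The length of the module `M` over `R`: the supremum of the lengths of chains of
submodules (expressed via the Krull dimension of the lattice of submodules). -/
noncomputable def modLength (R M : Type) [CommRing R] [AddCommGroup M] [Module R M] :
    WithBot ℕ∞ :=
  Order.krullDim (Submodule R M)

namespace S15
variable {R : Type} [CommRing R] 

def cocyc (X Y : ModuleCat.{0} R) (P : ProjectiveResolution X) (n : ℕ) :
    Submodule R (P.complex.X (n+1) ⟶ Y) where
  carrier := {f | P.complex.d (n+2) (n+1) ≫ f = 0}
  add_mem' := by intro a b ha hb; simp only [Set.mem_ofPred_eq] at *; simp [ha, hb]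
  zero_mem' := by simp
  smul_mem' := by intro c x hx; simp only [Set.mem_ofPred_eq] at *; simp [hx]

lemma mem_cocyc {X Y : ModuleCat.{0} R} {P : ProjectiveResolution X} {n : ℕ}
    {f : P.complex.X (n+1) ⟶ Y} : f ∈ cocyc X Y P n ↔ P.complex.d (n+2) (n+1) ≫ f = 0 := Iff.rfl

def extMkLin (X Y : ModuleCat.{0} R) (P : ProjectiveResolution X) (n : ℕ) :
    cocyc X Y P n →ₗ[R] Abelian.Ext X Y (n+1) where
  toFun f := P.extMk f.1 (n+2) rfl (mem_cocyc.1 f.2)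
  map_add' a b := by rw [P.add_extMk]; rfl
  map_smul' c a := by
    simp only [RingHom.id_apply]
    rw [Abelian.Ext.smul_eq_comp_mk₀, P.extMk_comp_mk₀]
    congr 1

def extEquiv (X Y : ModuleCat.{0} R) (n : ℕ) :
    ((Ext R (ModuleCat R) (n+1)).obj (op X)).obj Y ≃ₗ[R] Abelian.Ext X Y (n+1) := by
  let P := projectiveResolution X
  let K := P.complex.linearYonedaObj R Y
  let e1 := (P.isoExt (R := R) (n+1) Y ≪≫ K.homologyIsoSc' n (n+1) (n+2) (by simp) (by simp) ≪≫ 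
    (K.sc' n (n+1) (n+2)).moduleCatHomologyIso).toLinearEquiv
  let S := K.sc' n (n+1) (n+2)
  have hS : ∀ f : P.complex.X (n+1) ⟶ Y, f ∈ LinearMap.ker S.g.hom ↔ f ∈ cocyc X Y P n := fun f => Iff.rfl
  let e2 : LinearMap.ker S.g.hom →ₗ[R] cocyc X Y P n :=
    { toFun := fun f => ⟨f.1, (hS _).1 f.2⟩
      map_add' := fun a b => rfl
      map_smul' := fun a b => rfl }
  let ψ : LinearMap.ker S.g.hom →ₗ[R] Abelian.Ext X Y (n+1) := (extMkLin X Y P n).comp e2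
  have hs : Function.Surjective ψ := by
    intro a
    obtain ⟨f, hf, h⟩ := P.extMk_surjective a (n+2) rfl
    exact ⟨⟨f, (hS _).2 hf⟩, h⟩
  have hk : LinearMap.range S.moduleCatToCycles = LinearMap.ker ψ := by
    ext f
    rw [LinearMap.mem_ker]
    have h := P.extMk_eq_zero_iff (n := n+1) (e2 f).1 (n+2) rfl (mem_cocyc.1 (e2 f).2) n rfl
    refine Iff.trans ?_ h.symm
    constructor
    · rintro ⟨g, rfl⟩
      exact ⟨g, rfl⟩
    · rintro ⟨g, hg⟩
      exact ⟨g, Subtype.ext hg⟩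
  let e3 : (S.moduleCatLeftHomologyData.H : Type) ≃ₗ[R] Abelian.Ext X Y (n+1) := 
    (Submodule.quotEquivOfEq _ _ hk).trans (ψ.quotKerEquivOfSurjective hs)
  exact e1.trans e3

open scoped Pointwise

abbrev E (R : Type) [CommRing R] (i : ℕ) (N : Type) [AddCommGroup N] [Module R N] : Type :=
  Abelian.Ext (ModuleCat.of R N) (ModuleCat.of R R) i

def Emap (i : ℕ) {N N' : Type} [AddCommGroup N] [Module R N] [AddCommGroup N'] [Module R N']
    (f : N →ₗ[R] N') : E R i N' →ₗ[R] E R i N :=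
  (Abelian.Ext.mk₀ (ModuleCat.ofHom f)).precompOfLinear R (ModuleCat.of R R) (zero_add i)

lemma Emap_id (i : ℕ) {N : Type} [AddCommGroup N] [Module R N] :
    Emap (R := R) i (LinearMap.id : N →ₗ[R] N) = LinearMap.id := by
  ext x
  change (Abelian.Ext.mk₀ (𝟙 (ModuleCat.of R N))).comp x (zero_add i) = x
  simp

lemma Emap_smul (i : ℕ) {N N' : Type} [AddCommGroup N] [Module R N] [AddCommGroup N'] [Module R N']
    (a : R) (f : N →ₗ[R] N') : Emap (R := R) i (a • f) = a • Emap i f := by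
  ext x
  change (Abelian.Ext.mk₀ (a • (ModuleCat.ofHom f))).comp x (zero_add i) = a •
    (Abelian.Ext.mk₀ (ModuleCat.ofHom f)).comp x (zero_add i)
  rw [Abelian.Ext.mk₀_smul, Abelian.Ext.smul_comp]

lemma Emap_comp (i : ℕ) {N N' N'' : Type} [AddCommGroup N] [Module R N] [AddCommGroup N'] [Module R N']
    [AddCommGroup N''] [Module R N'']
    (f : N →ₗ[R] N') (g : N' →ₗ[R] N'') : Emap (R := R) i (g.comp f) = (Emap i f).comp (Emap i g) := by
  ext x
  change (Abelian.Ext.mk₀ (ModuleCat.ofHom f ≫ ModuleCat.ofHom g)).comp x (zero_add i) = 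
    (Abelian.Ext.mk₀ (ModuleCat.ofHom f)).comp ((Abelian.Ext.mk₀ (ModuleCat.ofHom g)).comp x (zero_add i)) (zero_add i)
  rw [Abelian.Ext.mk₀_comp_mk₀_assoc]

def Econgr (i : ℕ) {N N' : Type} [AddCommGroup N] [Module R N] [AddCommGroup N'] [Module R N']
    (e : N ≃ₗ[R] N') : E R i N' ≃ₗ[R] E R i N :=
  LinearEquiv.ofLinearMap (Emap i e.toLinearMap) (Emap i e.symm.toLinearMap)
    (by rw [← Emap_comp]; simp [Emap_id]) (by rw [← Emap_comp]; simp [Emap_id])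

lemma smul_E_eq_zero (i : ℕ) {N : Type} [AddCommGroup N] [Module R N] (a : R)
    (h : ∀ n : N, a • n = 0) (x : E R i N) : a • x = 0 := by
  have h1 : a • (LinearMap.id : N →ₗ[R] N) = 0 := by ext n; exact h n
  have h2 := Emap_smul i a (LinearMap.id : N →ₗ[R] N)
  have h3 : a • (LinearMap.id : N →ₗ[R] N) = (0:R) • LinearMap.id := by rw [h1, zero_smul]
  rw [h3, Emap_smul, Emap_id, zero_smul] at h2
  have := LinearMap.congr_fun h2 x
  simpa using this.symm

lemma subsingleton_E (i : ℕ) {N : Type} [AddCommGroup N] [Module R N] [Subsingleton N] :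
    Subsingleton (E R i N) := by
  refine ⟨fun a b => ?_⟩
  rw [← one_smul R a, ← one_smul R b, smul_E_eq_zero i 1 (fun n => Subsingleton.elim _ _),
    smul_E_eq_zero i 1 (fun n => Subsingleton.elim _ _)]

instance finite_E [IsNoetherianRing R] (i : ℕ) {N : Type} [AddCommGroup N] [Module R N] [Module.Finite R N] :
    Module.Finite R (E R i N) := ModuleCat.finite_ext R _ _ i

lemma les {N₁ N₂ N₃ : Type} [AddCommGroup N₁] [Module R N₁] [AddCommGroup N₂] [Module R N₂]
    [AddCommGroup N₃] [Module R N₃] (f : N₁ →ₗ[R] N₂) (g : N₂ →ₗ[R] N₃)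
    (hf : Function.Injective f) (hg : Function.Surjective g) (hfg : Function.Exact f g) (i : ℕ) :
    ∃ δ : E R i N₁ →ₗ[R] E R (i+1) N₃,
      Function.Exact (Emap i g) (Emap i f) ∧ Function.Exact (Emap i f) δ ∧
      Function.Exact δ (Emap (i+1) g) := by
  let S : ShortComplex (ModuleCat R) := 
    ModuleCat.shortComplexOfCompEqZero f g hfg.linearMap_comp_eq_zero
  have hS : S.ShortExact := 
    { exact := ModuleCat.shortComplex_exact _ hfg
      mono_f := (ModuleCat.mono_iff_injective _).2 hf
      epi_g := (ModuleCat.epi_iff_surjective _).2 hg }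
  refine ⟨hS.extClass.precompOfLinear R (ModuleCat.of R R) (add_comm 1 i), ?_, ?_, ?_⟩
  · exact (ShortComplex.ab_exact_iff_function_exact _).1
      (Abelian.Ext.contravariant_sequence_exact₂' hS (ModuleCat.of R R) i)
  · exact (ShortComplex.ab_exact_iff_function_exact _).1
      (Abelian.Ext.contravariant_sequence_exact₁' hS (ModuleCat.of R R) i (i+1) (add_comm 1 i))
  · exact (ShortComplex.ab_exact_iff_function_exact _).1
      (Abelian.Ext.contravariant_sequence_exact₃' hS (ModuleCat.of R R) i (i+1) (add_comm 1 i))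

lemma E_zero_injective {N₂ N₃ : Type} [AddCommGroup N₂] [Module R N₂]
    [AddCommGroup N₃] [Module R N₃] (g : N₂ →ₗ[R] N₃) (hg : Function.Surjective g) :
    Function.Injective (Emap (R := R) 0 g) := by
  have : Epi (ModuleCat.ofHom g) := (ModuleCat.epi_iff_surjective _).2 hg
  exact Abelian.Ext.precomp_mk₀_injective_of_epi (ModuleCat.of R R) (ModuleCat.ofHom g)

/-- the LES for multiplication by a regular element. -/
lemma les_smul {N : Type} [AddCommGroup N] [Module R N] (x : R) (hx : IsSMulRegular N x) (i : ℕ) :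
    ∃ (δ : E R i N →ₗ[R] E R (i+1) (QuotSMulTop x N)) (q : ∀ i, E R i (QuotSMulTop x N) →ₗ[R] E R i N),
      Function.Exact (q i) (LinearMap.lsmul R (E R i N) x) ∧
      Function.Exact (LinearMap.lsmul R (E R i N) x) δ ∧ Function.Exact δ (q (i+1)) ∧
      Function.Exact (q (i+1)) (LinearMap.lsmul R (E R (i+1) N) x) ∧ Function.Injective (q 0) := by
  have hex := LinearMap.exact_lsmul_mkQ_smul_top N x
  have hsurj := Submodule.mkQ_surjective (x • (⊤ : Submodule R N))
  have hm : ∀ i, Emap i (LinearMap.lsmul R N x) = LinearMap.lsmul R (E R i N) x := by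
    intro i
    have : LinearMap.lsmul R N x = x • LinearMap.id := by ext; simp
    rw [this, Emap_smul, Emap_id]; ext; simp
  obtain ⟨δ, h1, h2, h3⟩ := les (LinearMap.lsmul R N x) (Submodule.mkQ (x • (⊤ : Submodule R N))) hx
    hsurj hex i
  obtain ⟨δ', h1', -⟩ := les (LinearMap.lsmul R N x) (Submodule.mkQ (x • (⊤ : Submodule R N))) hx
    hsurj hex (i+1)
  rw [hm] at h1 h2 h1'
  exact ⟨δ, fun j => Emap j (Submodule.mkQ (x • (⊤ : Submodule R N))), h1, h2, h3, h1', E_zero_injective _ hsurj⟩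

/-- `N` is Gorenstein of codimension n -/
def IsC (R : Type) [CommRing R] (n : ℕ) (N : Type) [AddCommGroup N] [Module R N] : Prop :=
  (∀ i, i ≠ n → Subsingleton (E R i N)) ∧ Nonempty (E R n N ≃ₗ[R] N)

lemma IsC.congr {n : ℕ} {N N' : Type} [AddCommGroup N] [Module R N] [AddCommGroup N'] [Module R N']
    (h : IsC R n N) (e : N ≃ₗ[R] N') : IsC R n N' := by
  obtain ⟨h1, ⟨f⟩⟩ := h
  refine ⟨fun i hi => ?_, ⟨(Econgr n e).trans (f.trans e)⟩⟩
  have := h1 i hi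
  exact (Econgr i e).toEquiv.subsingleton

lemma isC_zero : IsC R 0 R := by
  refine ⟨fun i hi => ?_, ⟨?_⟩⟩
  · obtain ⟨j, rfl⟩ := Nat.exists_eq_succ_of_ne_zero hi
    refine ⟨fun a b => ?_⟩
    rw [Abelian.Ext.eq_zero_of_projective a, Abelian.Ext.eq_zero_of_projective b]
  · exact (Abelian.Ext.linearEquiv₀ (R := R)).trans (ModuleCat.homLinearEquiv (S := R)|>.trans (LinearMap.ringLmapEquivSelf R R R))

lemma IsC.quot {n : ℕ} {N : Type} [AddCommGroup N] [Module R N] (h : IsC R n N) (x : R)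
    (hx : IsSMulRegular N x) : IsC R (n+1) (QuotSMulTop x N) := by
  obtain ⟨h1, ⟨e⟩⟩ := h
  have hreg : ∀ i, Function.Injective (LinearMap.lsmul R (E R i N) x) := by
    intro i
    by_cases hi : i = n
    · subst hi
      intro a b hab
      apply e.injective
      apply hx
      simpa using congrArg e hab
    · have := h1 i hi
      exact Function.injective_of_subsingleton _
  constructor
  · intro i hi
    cases i with
    | zero =>
      obtain ⟨δ, q, h2, h3, h4, h5, h6⟩ := les_smul x hx 0
      refine ⟨fun a b => h6 (hreg 0 ?_)⟩
      rw [h2.apply_apply_eq_zero, h2.apply_apply_eq_zero]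
    | succ i =>
      obtain ⟨δ, q, h2, h3, h4, h5, h6⟩ := les_smul x hx i
      have := h1 i (by omega)
      refine ⟨fun a b => ?_⟩
      have hz : ∀ a : E R (i+1) (QuotSMulTop x N), a = 0 := by
        intro a
        have : q (i+1) a = 0 := hreg (i+1) (by rw [h5.apply_apply_eq_zero, map_zero])
        obtain ⟨c, rfl⟩ := (h4 a).1 this
        rw [Subsingleton.elim c 0, map_zero]
      rw [hz a, hz b]
  · obtain ⟨δ, q, h2, h3, h4, h5, h6⟩ := les_smul x hx n
    have hs : Function.Surjective δ := by
      intro a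
      have : q (n+1) a = 0 := hreg (n+1) (by rw [h5.apply_apply_eq_zero, map_zero])
      exact (h4 a).1 this
    have hk : LinearMap.ker δ = x • (⊤ : Submodule R (E R n N)) := by
      rw [h3.linearMap_ker_eq]
      ext a
      simp [Submodule.mem_smul_pointwise_iff_exists]
    exact ⟨(δ.quotKerEquivOfSurjective hs).symm.trans ((Submodule.quotEquivOfEq _ _ hk).trans
      (QuotSMulTop.congr x e))⟩

lemma IsC.quotList (rs : List R) : ∀ {n : ℕ} {N : Type} [AddCommGroup N] [Module R N], 
    IsC R n N → RingTheory.Sequence.IsWeaklyRegular N rs → 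
    IsC R (n + rs.length) (N ⧸ (Ideal.ofList rs • (⊤ : Submodule R N))) := by
  induction rs with
  | nil =>
    intro n N _ _ h _
    refine h.congr (Submodule.quotEquivOfEqBot _ (by simp)).symm
  | cons r rs ih =>
    intro n N _ _ h hr
    rw [RingTheory.Sequence.isWeaklyRegular_cons_iff] at hr
    have := ih (h.quot r hr.1) hr.2
    rw [List.length_cons, show n + (rs.length + 1) = n + 1 + rs.length by omega]
    exact this.congr (Submodule.quotOfListConsSMulTopEquivQuotSMulTopInner N r rs).symm

lemma isC_residue [IsLocalRing R] (rs : List R) (h : RingTheory.Sequence.IsWeaklyRegular R rs)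
    (hm : Ideal.ofList rs = IsLocalRing.maximalIdeal R) : IsC R rs.length (R ⧸ IsLocalRing.maximalIdeal R) := by
  have := isC_zero.quotList rs h
  rw [zero_add] at this
  exact this.congr (Submodule.quotEquivOfEq _ _ (by rw [hm]; simp))

open scoped Pointwise

/-- an additive function on modules -/
structure Len (R : Type) [CommRing R]
    (L : ∀ (N : Type) [AddCommGroup N] [Module R N], ℕ∞) : Prop where
  zero : ∀ (N : Type) [AddCommGroup N] [Module R N] [Subsingleton N], L N = 0
  add : ∀ {N₁ N₂ N₃ : Type} [AddCommGroup N₁] [Module R N₁] [AddCommGroup N₂] [Module R N₂]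
    [AddCommGroup N₃] [Module R N₃] (f : N₁ →ₗ[R] N₂) (g : N₂ →ₗ[R] N₃)
    (_ : Function.Injective f) (_ : Function.Surjective g) (_ : Function.Exact f g),
    L N₂ = L N₁ + L N₃

namespace Len
variable {L : ∀ (N : Type) [AddCommGroup N] [Module R N], ℕ∞} (hL : Len R L)
  {N₁ N₂ N₃ : Type} [AddCommGroup N₁] [Module R N₁] [AddCommGroup N₂] [Module R N₂]
    [AddCommGroup N₃] [Module R N₃]

include hL in
lemma congr (e : N₁ ≃ₗ[R] N₂) : L N₁ = L N₂ := by
  have := hL.add (N₃ := PUnit) e.toLinearMap 0 e.injective (Function.surjective_to_subsingleton _)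
      ((e.exact_zero_iff_surjective _).2 e.surjective)
  rw [this, hL.zero PUnit, add_zero]

include hL in
lemma ker_range (f : N₁ →ₗ[R] N₂) : L N₁ = L (LinearMap.ker f) + L (LinearMap.range f) := by
  refine hL.add (LinearMap.ker f).subtype f.rangeRestrict (Submodule.injective_subtype _)
    f.surjective_rangeRestrict ?_
  intro x
  simp [Subtype.ext_iff]

include hL in
lemma quot (S : Submodule R N₁) : L N₁ = L S + L (N₁ ⧸ S) :=
  hL.add S.subtype S.mkQ (Submodule.injective_subtype _) (Submodule.mkQ_surjective _)
    (LinearMap.exact_subtype_mkQ S)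

include hL in
lemma sub_le (S : Submodule R N₁) : L S ≤ L N₁ := by
  rw [hL.quot S]; exact le_self_add

include hL in
lemma range_le (f : N₁ →ₗ[R] N₂) : L (LinearMap.range f) ≤ L N₁ := by
  rw [hL.ker_range f]; exact le_add_self

include hL in
lemma exact_range {f : N₁ →ₗ[R] N₂} {g : N₂ →ₗ[R] N₃} (h : Function.Exact f g) :
    L N₂ = L (LinearMap.range f) + L (LinearMap.range g) := by
  rw [hL.ker_range g, h.linearMap_ker_eq]

include hL in
lemma exact_zero {f : N₁ →ₗ[R] N₂} {g : N₂ →ₗ[R] N₃} (h : Function.Exact f g)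
    (h1 : L N₁ = 0) (h3 : L N₃ = 0) : L N₂ = 0 := by
  rw [hL.exact_range h]
  have a := hL.range_le f
  have b := hL.sub_le (LinearMap.range g)
  rw [h1] at a; rw [h3] at b
  simp_all

include hL in
lemma ker_eq_of_injective {f : N₁ →ₗ[R] N₂} (h : Function.Injective f) :
    L (LinearMap.range f) = L N₁ :=
  (hL.congr (LinearEquiv.ofInjective f h)).symm
end Len

theorem devissage [IsNoetherianRing R] (T : Set (PrimeSpectrum R))
    (Q : ∀ (N : Type) [AddCommGroup N] [Module R N] [Module.Finite R N], Prop)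
    (h0 : ∀ (N : Type) [AddCommGroup N] [Module R N] [Module.Finite R N], Subsingleton N → Q N)
    (h1 : ∀ (N : Type) [AddCommGroup N] [Module R N] [Module.Finite R N] (p : PrimeSpectrum R),
      p ∈ T → (N ≃ₗ[R] (R ⧸ p.asIdeal)) → Q N)
    (h2 : ∀ (N₁ N₂ N₃ : Type) [AddCommGroup N₁] [Module R N₁] [Module.Finite R N₁]
      [AddCommGroup N₂] [Module R N₂] [Module.Finite R N₂]
      [AddCommGroup N₃] [Module R N₃] [Module.Finite R N₃]
      (f : N₁ →ₗ[R] N₂) (g : N₂ →ₗ[R] N₃),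
      Function.Injective f → Function.Surjective g → Function.Exact f g → Q N₁ → Q N₃ → Q N₂)
    (N : Type) [AddCommGroup N] [Module R N] [hN : Module.Finite R N] (hT : Module.support R N ⊆ T) :
    Q N := by
  induction hN using IsNoetherianRing.induction_on_isQuotientEquivQuotientPrime R with
  | subsingleton N => exact h0 N inferInstance
  | quotient N p f =>
    refine h1 N p (hT ?_) f
    rw [f.support_eq, Module.support_eq_zeroLocus, Ideal.annihilator_quotient]
    simp
  | exact N₁ N₂ N₃ f g hf hg hfg ih₁ ih₃ =>
    rw [Module.support_of_exact hfg hf hg] at hT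
    exact h2 N₁ N₂ N₃ f g hf hg hfg (ih₁ (Set.subset_union_left.trans hT))
      (ih₃ (Set.subset_union_right.trans hT))

/-- the property propagated by the dévissage -/
def Good (R : Type) [CommRing R] (L : ∀ (N : Type) [AddCommGroup N] [Module R N], ℕ∞) (d : ℕ)
    (N : Type) [AddCommGroup N] [Module R N] : Prop :=
  L N ≠ ⊤ ∧ L (E R d N) = L N ∧ ∀ i, i ≠ d → L (E R i N) = 0

lemma Good.congr {L : ∀ (N : Type) [AddCommGroup N] [Module R N], ℕ∞} (hL : Len R L) {d : ℕ}
    {N N' : Type} [AddCommGroup N] [Module R N] [AddCommGroup N'] [Module R N'] (h : Good R L d N)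
    (e : N ≃ₗ[R] N') : Good R L d N' := by
  obtain ⟨h1, h2, h3⟩ := h
  refine ⟨?_, ?_, fun i hi => ?_⟩
  · rwa [← hL.congr e]
  · rw [hL.congr (Econgr d e), h2, hL.congr e]
  · rw [hL.congr (Econgr i e), h3 i hi]

lemma Good.exact {L : ∀ (N : Type) [AddCommGroup N] [Module R N], ℕ∞} (hL : Len R L) {d : ℕ}
    {N₁ N₂ N₃ : Type} [AddCommGroup N₁] [Module R N₁] [AddCommGroup N₂] [Module R N₂]
    [AddCommGroup N₃] [Module R N₃] (f : N₁ →ₗ[R] N₂) (g : N₂ →ₗ[R] N₃)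
    (hf : Function.Injective f) (hg : Function.Surjective g) (hfg : Function.Exact f g)
    (h1 : Good R L d N₁) (h3 : Good R L d N₃) : Good R L d N₂ := by
  obtain ⟨a1, b1, c1⟩ := h1
  obtain ⟨a3, b3, c3⟩ := h3
  refine ⟨?_, ?_, fun i hi => ?_⟩
  · rw [hL.add f g hf hg hfg]; exact WithTop.add_ne_top.2 ⟨a1, a3⟩
  · obtain ⟨δ, e1, e2, e3⟩ := les f g hf hg hfg d
    have k1 := hL.exact_range e1
    have k2 := hL.exact_range e2
    have hr : L (LinearMap.range δ) = 0 :=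
      le_antisymm ((hL.sub_le _).trans (c3 (d+1) (by omega)).le) (zero_le)
    rw [hr, add_zero, b1] at k2
    have k3 : L (LinearMap.range (Emap d g)) = L N₃ := by
      cases d with
      | zero => rw [hL.ker_eq_of_injective (E_zero_injective g hg), b3]
      | succ d =>
        obtain ⟨δ', e1', e2', e3'⟩ := les f g hf hg hfg d
        have hr' : L (LinearMap.range δ') = 0 :=
          le_antisymm ((hL.range_le _).trans (c1 d (by omega)).le) (zero_le)
        have := hL.exact_range e3'
        rw [hr', zero_add, b3] at this
        exact this.symm
    rw [k1, k3, ← k2, hL.add f g hf hg hfg, add_comm]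
  · obtain ⟨δ, e1, e2, e3⟩ := les f g hf hg hfg i
    exact hL.exact_zero e1 (c3 i hi) (c1 i hi)

theorem good_of_support [IsNoetherianRing R] {L : ∀ (N : Type) [AddCommGroup N] [Module R N], ℕ∞}
    (hL : Len R L) (d : ℕ) (T : Set (PrimeSpectrum R))
    (h : ∀ p ∈ T, Good R L d (R ⧸ p.asIdeal))
    (N : Type) [AddCommGroup N] [Module R N] [Module.Finite R N] (hT : Module.support R N ⊆ T) :
    Good R L d N := by
  refine devissage T (fun N _ _ _ => Good R L d N) ?_ ?_ ?_ N hT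
  · intro N _ _ _ _
    have hs : ∀ i, Subsingleton (E R i N) := fun i => subsingleton_E i
    exact ⟨by rw [hL.zero N]; simp, by rw [hL.zero N, hL.zero _], fun i _ => hL.zero _⟩
  · intro N _ _ _ p hp e
    exact (h p hp).congr hL e.symm
  · intro N₁ N₂ N₃ _ _ _ _ _ _ _ _ _ f g hf hg hfg h1 h3
    exact h1.exact hL f g hf hg hfg h3

lemma len_length : Len R (fun N _ _ => Module.length R N) where
  zero N := by intros; exact Module.length_eq_zero_iff.2 inferInstance
  add f g hf hg hfg := Module.length_eq_add_of_exact f g hf hg hfg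

/-- finite length modules over a regular local ring -/
theorem good_residue [IsNoetherianRing R] [IsLocalRing R] (rs : List R)
    (h : RingTheory.Sequence.IsWeaklyRegular R rs)
    (hm : Ideal.ofList rs = IsLocalRing.maximalIdeal R)
    (N : Type) [AddCommGroup N] [Module R N] [Module.Finite R N]
    (hT : ∀ p ∈ Module.support R N, p = IsLocalRing.closedPoint R) :
    Good R (fun N _ _ => Module.length R N) rs.length N := by
  refine good_of_support len_length _ {IsLocalRing.closedPoint R} ?_ N (fun p hp => hT p hp)
  rintro p rfl
  obtain ⟨h1, ⟨e⟩⟩ := isC_residue rs h hm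
  have hs : IsSimpleModule R (R ⧸ IsLocalRing.maximalIdeal R) :=
    isSimpleModule_iff_quot_maximal.2 ⟨_, inferInstance, ⟨LinearEquiv.refl _ _⟩⟩
  refine ⟨?_, e.length_eq, fun i hi => ?_⟩
  · have := Module.length_eq_one_iff.2 hs
    change Module.length R (R ⧸ IsLocalRing.maximalIdeal R) ≠ ⊤
    rw [this]; simp
  · have := h1 i hi
    exact Module.length_eq_zero_iff.2 this


/-- kernel of multiplication by x -/
abbrev KK (x : R) (N : Type) [AddCommGroup N] [Module R N] : Type :=
  LinearMap.ker (LinearMap.lsmul R N x)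

/-- cokernel of multiplication by x -/
abbrev QQ (x : R) (N : Type) [AddCommGroup N] [Module R N] : Type :=
  N ⧸ LinearMap.range (LinearMap.lsmul R N x)

lemma herbrand_exact {L : ∀ (N : Type) [AddCommGroup N] [Module R N], ℕ∞} (hL : Len R L) (x : R)
    {N₁ N₂ N₃ : Type} [AddCommGroup N₁] [Module R N₁] [AddCommGroup N₂] [Module R N₂]
    [AddCommGroup N₃] [Module R N₃] (f : N₁ →ₗ[R] N₂) (g : N₂ →ₗ[R] N₃)
    (hf : Function.Injective f) (hg : Function.Surjective g) (hfg : Function.Exact f g) :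
    L (QQ x N₂) + L (KK x N₁) + L (KK x N₃) = L (KK x N₂) + L (QQ x N₁) + L (QQ x N₃) ∧
    L (KK x N₂) ≤ L (KK x N₁) + L (KK x N₃) := by
  have h₁ : f ∘ₗ (LinearMap.lsmul R N₁ x) = (LinearMap.lsmul R N₂ x) ∘ₗ f := by ext; simp
  have h₂ : g ∘ₗ (LinearMap.lsmul R N₂ x) = (LinearMap.lsmul R N₃ x) ∘ₗ g := by ext; simp
  let F12 : KK x N₁ →ₗ[R] KK x N₂ := f.restrict (by
    intro a ha
    simp only [LinearMap.mem_ker, LinearMap.lsmul_apply] at ha ⊢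
    rw [← map_smul, ha, map_zero])
  let F23 : KK x N₂ →ₗ[R] KK x N₃ := g.restrict (by
    intro a ha
    simp only [LinearMap.mem_ker, LinearMap.lsmul_apply] at ha ⊢
    rw [← map_smul, ha, map_zero])
  let G12 : QQ x N₁ →ₗ[R] QQ x N₂ := Submodule.mapQ _ _ f (by
    rintro _ ⟨a, rfl⟩
    exact ⟨f a, by simp⟩)
  let G23 : QQ x N₂ →ₗ[R] QQ x N₃ := Submodule.mapQ _ _ g (by
    rintro _ ⟨a, rfl⟩
    exact ⟨g a, by simp⟩)
  have i12 : Function.Injective F12 := by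
    intro a b hab
    exact Subtype.ext (hf (congrArg Subtype.val hab))
  have ex2 : Function.Exact F12 F23 := by
    intro a
    constructor
    · intro h
      have h' : g a.1 = 0 := congrArg Subtype.val h
      obtain ⟨b, hb⟩ := (hfg _).1 h'
      have hb' : b ∈ LinearMap.ker (LinearMap.lsmul R N₁ x) := by
        simp only [LinearMap.mem_ker, LinearMap.lsmul_apply]
        apply hf
        rw [map_smul, hb, map_zero]
        exact LinearMap.mem_ker.1 a.2
      exact ⟨⟨b, hb'⟩, Subtype.ext hb⟩
    · rintro ⟨b, rfl⟩
      exact Subtype.ext (hfg.apply_apply_eq_zero _)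
  have s23 : Function.Surjective G23 := by
    intro a
    obtain ⟨a, rfl⟩ := Submodule.mkQ_surjective _ a
    obtain ⟨b, rfl⟩ := hg a
    exact ⟨Submodule.mkQ _ b, by simp [G23]⟩
  have ex5 : Function.Exact G12 G23 := by
    intro a
    constructor
    · obtain ⟨a, rfl⟩ := Submodule.mkQ_surjective _ a
      intro h
      have h' : g a ∈ LinearMap.range (LinearMap.lsmul R N₃ x) :=
        (Submodule.Quotient.mk_eq_zero _).1 h
      obtain ⟨c, hc⟩ := h'
      obtain ⟨b, rfl⟩ := hg c
      have : g (a - x • b) = 0 := by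
        rw [map_sub, map_smul, sub_eq_zero, ← hc]; rfl
      obtain ⟨e, he⟩ := (hfg _).1 this
      refine ⟨Submodule.mkQ _ e, ?_⟩
      change Submodule.mkQ _ (f e) = _
      rw [he, map_sub, sub_eq_self]
      exact (Submodule.Quotient.mk_eq_zero _).2 ⟨b, rfl⟩
    · rintro ⟨b, rfl⟩
      obtain ⟨b, rfl⟩ := Submodule.mkQ_surjective _ b
      change Submodule.mkQ _ (g (f b)) = 0
      rw [hfg.apply_apply_eq_zero, map_zero]
  let δ := SnakeLemma.δ' (LinearMap.lsmul R N₁ x) (LinearMap.lsmul R N₂ x) (LinearMap.lsmul R N₃ x)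
    f g hfg f g hfg h₁ h₂ (LinearMap.ker (LinearMap.lsmul R N₃ x)).subtype
    (LinearMap.exact_subtype_ker_map _) (LinearMap.range (LinearMap.lsmul R N₁ x)).mkQ
    (LinearMap.exact_map_mkQ_range _) hg hf
  have ex3 : Function.Exact F23 δ := 
    SnakeLemma.exact_δ'_right (LinearMap.lsmul R N₁ x) (LinearMap.lsmul R N₂ x) (LinearMap.lsmul R N₃ x)
      f g hfg f g hfg h₁ h₂ (LinearMap.ker (LinearMap.lsmul R N₂ x)).subtype
      (LinearMap.exact_subtype_ker_map _) (LinearMap.ker (LinearMap.lsmul R N₃ x)).subtype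
      (LinearMap.exact_subtype_ker_map _) (LinearMap.range (LinearMap.lsmul R N₁ x)).mkQ
      (LinearMap.exact_map_mkQ_range _) hg hf F23 (by ext; rfl) (Submodule.injective_subtype _)
  have ex4 : Function.Exact δ G12 := 
    SnakeLemma.exact_δ'_left (LinearMap.lsmul R N₁ x) (LinearMap.lsmul R N₂ x) (LinearMap.lsmul R N₃ x)
      f g hfg f g hfg h₁ h₂ (LinearMap.ker (LinearMap.lsmul R N₃ x)).subtype
      (LinearMap.exact_subtype_ker_map _) (LinearMap.range (LinearMap.lsmul R N₁ x)).mkQ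
      (LinearMap.exact_map_mkQ_range _) (LinearMap.range (LinearMap.lsmul R N₂ x)).mkQ
      (LinearMap.exact_map_mkQ_range _) hg hf G12 (by ext; rfl) (Submodule.mkQ_surjective _)
  have l2 := hL.exact_range ex2
  have l3 := hL.exact_range ex3
  have l4 := hL.exact_range ex4
  have l5 := hL.exact_range ex5
  rw [hL.ker_eq_of_injective i12] at l2
  have l6 : L (LinearMap.range G23) = L (QQ x N₃) :=
    hL.congr (LinearEquiv.ofTop _ (LinearMap.range_eq_top.2 s23))
  rw [l6] at l5
  constructor
  · rw [l2, l3, l4, l5]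
    ac_rfl
  · rw [l2]
    gcongr
    exact hL.sub_le _

section Loc
variable (P : PrimeSpectrum R)

/-- length of the localization -/
def ρ (N : Type) [AddCommGroup N] [Module R N] : ℕ∞ :=
  Module.length (Localization P.asIdeal.primeCompl) (LocalizedModule P.asIdeal.primeCompl N)

lemma len_ρ : Len R (fun N _ _ => ρ P N) where
  zero N := by
    intros
    refine Module.length_eq_zero_iff.2 ?_
    rw [LocalizedModule.subsingleton_iff]
    exact fun m => ⟨1, Submonoid.one_mem _, Subsingleton.elim _ _⟩
  add f g hf hg hfg := by
    refine Module.length_eq_add_of_exact (LocalizedModule.map P.asIdeal.primeCompl f)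
      (LocalizedModule.map P.asIdeal.primeCompl g) (LocalizedModule.map_injective _ _ hf)
      (LocalizedModule.map_surjective _ _ hg) ?_
    exact LocalizedModule.map_exact _ f g hfg

lemma ρ_zero_of_smul {N : Type} [AddCommGroup N] [Module R N] (a : R) (ha : a ∉ P.asIdeal)
    (h : ∀ n : N, a • n = 0) : ρ P N = 0 := by
  refine Module.length_eq_zero_iff.2 ?_
  rw [LocalizedModule.subsingleton_iff]
  exact fun m => ⟨a, ha, h m⟩

lemma ρ_self : ρ P (R ⧸ P.asIdeal) = 1 := by
  refine Module.length_eq_one_iff.2 ?_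
  have hn : Nontrivial (LocalizedModule P.asIdeal.primeCompl (R ⧸ P.asIdeal)) := by
    rw [← Module.mem_support_iff, Module.support_eq_zeroLocus, Ideal.annihilator_quotient]
    simp
  rw [isSimpleModule_iff_toSpanSingleton_surjective]
  refine ⟨hn, ?_⟩
  intro u hu v
  induction u using LocalizedModule.induction_on with | _ a s
  induction v using LocalizedModule.induction_on with | _ b t
  obtain ⟨a, rfl⟩ := Ideal.Quotient.mk_surjective a
  obtain ⟨b, rfl⟩ := Ideal.Quotient.mk_surjective b
  have ha : a ∈ P.asIdeal.primeCompl := by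
    intro ha
    apply hu
    rw [Ideal.Quotient.eq_zero_iff_mem.2 ha, LocalizedModule.zero_mk]
  refine ⟨Localization.mk (b * s.1) (⟨a, ha⟩ * t), ?_⟩
  rw [LinearMap.toSpanSingleton_apply, LocalizedModule.mk_smul_mk, LocalizedModule.mk_eq]
  refine ⟨1, ?_⟩
  simp only [one_smul, Submonoid.smul_def, Submonoid.coe_mul, Algebra.smul_def,
    Ideal.Quotient.algebraMap_eq, ← map_mul]
  congr 1; ring
end Loc

open scoped Pointwise

lemma range_lsmul_eq (x : R) (N : Type) [AddCommGroup N] [Module R N] :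
    LinearMap.range (LinearMap.lsmul R N x) = x • (⊤ : Submodule R N) := by
  ext a
  simp [Submodule.mem_smul_pointwise_iff_exists]

def QQequiv (x : R) (N : Type) [AddCommGroup N] [Module R N] : QQ x N ≃ₗ[R] QuotSMulTop x N :=
  Submodule.quotEquivOfEq _ _ (range_lsmul_eq x N)

lemma subsingleton_of_smul_surj [IsLocalRing R] {N : Type} [AddCommGroup N] [Module R N]
    [Module.Finite R N] (x : R) (hx : x ∈ IsLocalRing.maximalIdeal R)
    (h : Function.Surjective (LinearMap.lsmul R N x)) : Subsingleton N := by
  have : (⊤ : Submodule R N) = ⊥ := by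
    refine Submodule.eq_bot_of_le_smul_of_le_jacobson_bot (IsLocalRing.maximalIdeal R) ⊤
      Module.Finite.fg_top ?_ (IsLocalRing.maximalIdeal_le_jacobson _)
    intro a _
    obtain ⟨b, rfl⟩ := h a
    exact Submodule.smul_mem_smul hx trivial
  exact (Submodule.subsingleton_iff R).1 (subsingleton_of_bot_eq_top this.symm)

section Main
variable [IsNoetherianRing R] [IsLocalRing R] (rs : List R)
    (h : RingTheory.Sequence.IsWeaklyRegular R rs)
    (hm : Ideal.ofList rs = IsLocalRing.maximalIdeal R) (r : ℕ) (hrs : rs.length = r + 1)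
    (P : PrimeSpectrum R)
    (hP : ∀ q : PrimeSpectrum R, P ≤ q → q = P ∨ q = IsLocalRing.closedPoint R)
    (x : R) (hx : x ∈ IsLocalRing.maximalIdeal R) (hxP : x ∉ P.asIdeal)

omit [IsNoetherianRing R] in
include hP hxP in
lemma supp_quot : ∀ q ∈ Module.support R (QuotSMulTop x (R ⧸ P.asIdeal)),
    q = IsLocalRing.closedPoint R := by
  intro q hq
  rw [Module.mem_support_iff_of_finite] at hq
  have h1 : P ≤ q := by
    intro a ha
    apply hq
    rw [Module.mem_annihilator]
    intro n
    obtain ⟨n, rfl⟩ := Submodule.mkQ_surjective _ n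
    rw [← map_smul]
    obtain ⟨n, rfl⟩ := Ideal.Quotient.mk_surjective n
    rw [Algebra.smul_def, Ideal.Quotient.algebraMap_eq, Ideal.Quotient.eq_zero_iff_mem.2 ha,
      zero_mul, map_zero]
  rcases hP q h1 with rfl | rfl
  · exfalso
    apply hxP
    apply hq
    rw [Module.mem_annihilator]
    intro n
    obtain ⟨n, rfl⟩ := Submodule.mkQ_surjective _ n
    rw [← map_smul]
    exact (Submodule.Quotient.mk_eq_zero _).2 (Submodule.smul_mem_pointwise_smul _ _ _ trivial)
  · rfl

include h hm hP hx hxP hrs in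
theorem L7 : (∀ i, i ≠ r → Subsingleton (E R i (R ⧸ P.asIdeal))) ∧
    IsSMulRegular (E R r (R ⧸ P.asIdeal)) x ∧
    Module.length R (QQ x (E R r (R ⧸ P.asIdeal))) = Module.length R (QQ x (R ⧸ P.asIdeal)) ∧
    Module.length R (QQ x (R ⧸ P.asIdeal)) ≠ ⊤ ∧ Module.length R (QQ x (R ⧸ P.asIdeal)) ≠ 0 := by
  have hreg : IsSMulRegular (R ⧸ P.asIdeal) x := by
    rw [isSMulRegular_iff_right_eq_zero_of_smul]
    intro n hn
    obtain ⟨n, rfl⟩ := Ideal.Quotient.mk_surjective n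
    rw [Algebra.smul_def, Ideal.Quotient.algebraMap_eq, ← map_mul,
      Ideal.Quotient.eq_zero_iff_mem] at hn
    exact Ideal.Quotient.eq_zero_iff_mem.2 ((P.2.mem_or_mem hn).resolve_left hxP)
  obtain ⟨g1, g2, g3⟩ := good_residue rs h hm (QuotSMulTop x (R ⧸ P.asIdeal))
    (supp_quot P hP x hxP)
  rw [hrs] at g2 g3
  beta_reduce at g1 g2 g3
  have g3' : ∀ i, i ≠ r + 1 → Subsingleton (E R i (QuotSMulTop x (R ⧸ P.asIdeal))) :=
    fun i hi => Module.length_eq_zero_iff.1 (g3 i hi)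
  have A : ∀ i, i ≠ r → Subsingleton (E R i (R ⧸ P.asIdeal)) := by
    intro i hi
    obtain ⟨δ, q, h2, h3, h4, h5, h6⟩ := les_smul x hreg i
    have := g3' (i+1) (by omega)
    refine subsingleton_of_smul_surj x hx ?_
    intro a
    exact (h3 a).1 (Subsingleton.elim _ _)
  obtain ⟨δ, q, h2, h3, h4, h5, h6⟩ := les_smul x hreg r
  have s1 := g3' r (by omega)
  have s2 := A (r+1) (by omega)
  refine ⟨A, ?_, ?_, ?_, ?_⟩
  · rw [isSMulRegular_iff_right_eq_zero_of_smul]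
    intro a ha
    obtain ⟨b, rfl⟩ := (h2 a).1 ha
    rw [Subsingleton.elim b 0, map_zero]
  · have hs : Function.Surjective δ := fun a => (h4 a).1 (Subsingleton.elim _ _)
    rw [(QQequiv x (R ⧸ P.asIdeal)).length_eq, ← g2]
    exact ((Submodule.quotEquivOfEq _ _ h3.linearMap_ker_eq.symm).trans
      (δ.quotKerEquivOfSurjective hs)).length_eq
  · rw [(QQequiv x (R ⧸ P.asIdeal)).length_eq]; exact g1
  · intro h0
    have h0' := Module.length_eq_zero_iff.1 h0
    have := subsingleton_of_smul_surj (N := R ⧸ P.asIdeal) x hx (by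
      rw [← LinearMap.range_eq_top]
      exact Submodule.Quotient.subsingleton_iff.1 h0')
    exact not_subsingleton _ this

include hP hx hxP in
theorem L8 (N : Type) [AddCommGroup N] [Module R N] [Module.Finite R N]
    (hN : ∀ q ∈ Module.support R N, P ≤ q)
    (hPm : P ≠ IsLocalRing.closedPoint R) :
    Module.length R (KK x N) ≠ ⊤ ∧ Module.length R (QQ x N) =
      Module.length R (KK x N) + Module.length R (QQ x (R ⧸ P.asIdeal)) * ρ P N := by
  have hLen : Len R (fun N _ _ => Module.length R N) := len_length
  have kcongr : ∀ {N N' : Type} [AddCommGroup N] [Module R N] [AddCommGroup N'] [Module R N']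
      (e : N ≃ₗ[R] N'), Module.length R (KK x N) = Module.length R (KK x N') ∧
        Module.length R (QQ x N) = Module.length R (QQ x N') := by
    intro N N' _ _ _ _ e
    constructor
    · refine (e.submoduleMap _ |>.trans (LinearEquiv.ofEq _ _ ?_)).length_eq
      ext a
      simp [Submodule.mem_map_equiv, ← map_smul]
    · refine (Submodule.Quotient.equiv _ _ e ?_).length_eq
      ext a
      constructor
      · rintro ⟨_, ⟨b, rfl⟩, rfl⟩
        exact ⟨e b, by simp⟩
      · rintro ⟨b, rfl⟩
        exact ⟨x • e.symm b, ⟨e.symm b, rfl⟩, by simp⟩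
  refine devissage {q | q = P ∨ q = IsLocalRing.closedPoint R} 
    (fun N _ _ _ => Module.length R (KK x N) ≠ ⊤ ∧ Module.length R (QQ x N) =
      Module.length R (KK x N) + Module.length R (QQ x (R ⧸ P.asIdeal)) * ρ P N) ?_ ?_ ?_ N ?_
  · intro N _ _ _ hs
    rw [(len_ρ P).zero N, hLen.zero (KK x N), hLen.zero (QQ x N)]
    simp
  · intro N _ _ _ p hp e
    rw [(kcongr e).1, (kcongr e).2, (len_ρ P).congr e]
    rcases hp with rfl | rfl
    · have hk : Subsingleton (KK x (R ⧸ p.asIdeal)) := by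
        rw [Submodule.subsingleton_iff_eq_bot, LinearMap.ker_eq_bot']
        intro n hn
        obtain ⟨n, rfl⟩ := Ideal.Quotient.mk_surjective n
        rw [LinearMap.lsmul_apply, Algebra.smul_def, Ideal.Quotient.algebraMap_eq, ← map_mul,
          Ideal.Quotient.eq_zero_iff_mem] at hn
        exact Ideal.Quotient.eq_zero_iff_mem.2 ((p.2.mem_or_mem hn).resolve_left hxP)
      rw [hLen.zero (KK x _), ρ_self]
      simp
    · have hxz : ∀ n : R ⧸ (IsLocalRing.closedPoint R).asIdeal, x • n = 0 := by
        intro n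
        obtain ⟨n, rfl⟩ := Ideal.Quotient.mk_surjective n
        rw [Algebra.smul_def, Ideal.Quotient.algebraMap_eq, ← map_mul,
          Ideal.Quotient.eq_zero_iff_mem]
        exact Ideal.mul_mem_right _ _ hx
      have hz : LinearMap.lsmul R (R ⧸ (IsLocalRing.closedPoint R).asIdeal) x = 0 := by
        refine LinearMap.ext fun n => ?_
        exact hxz n
      have hs : IsSimpleModule R (R ⧸ (IsLocalRing.closedPoint R).asIdeal) :=
        isSimpleModule_iff_quot_maximal.2
          ⟨IsLocalRing.maximalIdeal R, inferInstance, ⟨LinearEquiv.refl _ _⟩⟩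
      have h1 := Module.length_eq_one_iff.2 hs
      have hρ : ρ P (R ⧸ (IsLocalRing.closedPoint R).asIdeal) = 0 := by
        refine ρ_zero_of_smul P x hxP hxz
      have hk : Module.length R (KK x (R ⧸ (IsLocalRing.closedPoint R).asIdeal)) = 1 := by
        rw [← h1]
        exact (LinearEquiv.ofTop _ (by rw [hz, LinearMap.ker_zero])).length_eq
      have hq : Module.length R (QQ x (R ⧸ (IsLocalRing.closedPoint R).asIdeal)) = 1 := by
        rw [← h1]
        exact (Submodule.quotEquivOfEqBot _ (by rw [hz, LinearMap.range_zero])).length_eq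
      rw [hk, hq, hρ]
      simp
  · intro N₁ N₂ N₃ _ _ _ _ _ _ _ _ _ f g hf hg hfg ⟨a1, b1⟩ ⟨a3, b3⟩
    obtain ⟨c1, c2⟩ := herbrand_exact hLen x f g hf hg hfg
    have hfin : Module.length R (KK x N₁) + Module.length R (KK x N₃) ≠ ⊤ :=
      WithTop.add_ne_top.2 ⟨a1, a3⟩
    refine ⟨ne_top_of_le_ne_top hfin c2, ?_⟩
    rw [(len_ρ P).add f g hf hg hfg]
    rw [b1, b3] at c1
    refine ENat.add_left_injective_of_ne_top hfin ?_
    beta_reduce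
    rw [← add_assoc]
    refine c1.trans ?_
    rw [mul_add]
    ac_rfl
  · intro q hq
    exact hP q (hN q hq)

include h hm hP hx hxP hrs in
theorem good_P (hPm : P ≠ IsLocalRing.closedPoint R) :
    Good R (fun N _ _ => ρ P N) r (R ⧸ P.asIdeal) := by
  obtain ⟨h1, h2, h3, h4, h5⟩ := L7 rs h hm r hrs P hP x hx hxP
  refine ⟨?_, ?_, fun i hi => ?_⟩
  · change ρ P (R ⧸ P.asIdeal) ≠ ⊤
    rw [ρ_self]; simp
  · obtain ⟨a, b⟩ := L8 P hP x hx hxP (E R r (R ⧸ P.asIdeal)) (by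
      intro q hq
      rw [Module.mem_support_iff_of_finite] at hq
      intro y hy
      apply hq
      rw [Module.mem_annihilator]
      refine smul_E_eq_zero r y ?_
      intro n
      obtain ⟨n, rfl⟩ := Ideal.Quotient.mk_surjective n
      rw [Algebra.smul_def, Ideal.Quotient.algebraMap_eq, Ideal.Quotient.eq_zero_iff_mem.2 hy,
        zero_mul]) hPm
    have hk : Subsingleton (KK x (E R r (R ⧸ P.asIdeal))) := by
      rw [Submodule.subsingleton_iff_eq_bot, LinearMap.ker_eq_bot]
      exact h2
    rw [h3, Module.length_eq_zero_iff.2 hk, zero_add] at b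
    change ρ P (E R r (R ⧸ P.asIdeal)) = ρ P (R ⧸ P.asIdeal)
    rw [ρ_self]
    generalize Module.length R (QQ x (R ⧸ P.asIdeal)) = c at *
    generalize ρ P (E R r (R ⧸ P.asIdeal)) = y at *
    lift c to ℕ using h4
    have h5' : c ≠ 0 := by simpa using h5
    have hy : y ≠ ⊤ := by
      rintro rfl
      rw [ENat.mul_top h5] at b
      exact absurd b (by simp)
    lift y to ℕ using hy
    norm_cast at b ⊢
    exact (mul_left_cancel₀ h5' (by rw [mul_one]; exact b)).symm
  · have := h1 i hi
    exact (len_ρ P).zero _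
end Main

section Main2
variable [IsNoetherianRing R] [IsLocalRing R] (rs : List R)
    (h : RingTheory.Sequence.IsWeaklyRegular R rs)
    (hm : Ideal.ofList rs = IsLocalRing.maximalIdeal R) (r : ℕ) (hrs : rs.length = r + 1)

include h hm hrs in
lemma height_closedPoint : Order.height (IsLocalRing.closedPoint R) = ((r + 1 : ℕ) : ℕ∞) := by
  have hreg : RingTheory.Sequence.IsRegular R rs := by
    refine ⟨h, ?_⟩
    rw [hm]
    simpa using (IsLocalRing.maximalIdeal.isMaximal R).ne_top.symm
  have h1 := ringKrullDim_add_length_eq_ringKrullDim_of_isRegular rs hreg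
  rw [hm, hrs, ← IsLocalRing.maximalIdeal_height_eq_ringKrullDim (R := R)] at h1
  have h2 : ringKrullDim (R ⧸ IsLocalRing.maximalIdeal R) = 0 :=
    letI := Ideal.Quotient.field (IsLocalRing.maximalIdeal R)
    ringKrullDim_eq_zero_of_field _
  rw [h2, zero_add] at h1
  rw [← PrimeSpectrum.height_eq_orderHeight]
  exact_mod_cast h1.symm

include h hm hrs in
theorem good_main (P : PrimeSpectrum R) (hht : Order.height P = (r : ℕ∞))
    (N : Type) [AddCommGroup N] [Module R N] [Module.Finite R N]
    (hN : ∀ q ∈ Module.support R N, (r : ℕ∞) ≤ Order.height q) :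
    Good R (fun N _ _ => ρ P N) r N := by
  have hc := height_closedPoint rs h hm r hrs
  have hPm : P ≠ IsLocalRing.closedPoint R := by
    rintro rfl
    rw [hht] at hc
    have : r = r + 1 := by exact_mod_cast hc
    omega
  have hP : ∀ q : PrimeSpectrum R, P ≤ q → q = P ∨ q = IsLocalRing.closedPoint R := by
    intro q hq
    by_contra! hne
    have l1 : P < q := lt_of_le_of_ne hq hne.1.symm
    have l2 : q < IsLocalRing.closedPoint R :=
      lt_of_le_of_ne (IsLocalRing.le_maximalIdeal q.2.ne_top) hne.2
    have h1 := Order.height_add_one_le l1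
    have h2 := Order.height_add_one_le l2
    rw [hht] at h1
    rw [hc] at h2
    have h3 : (r : ℕ∞) + 1 + 1 ≤ ((r + 1 : ℕ) : ℕ∞) := le_trans (by gcongr) h2
    have h4 : r + 1 + 1 ≤ r + 1 := by exact_mod_cast h3
    omega
  obtain ⟨x, hx, hxP⟩ : ∃ x ∈ IsLocalRing.maximalIdeal R, x ∉ P.asIdeal := by
    by_contra! hcon
    rcases hP (IsLocalRing.closedPoint R) (IsLocalRing.le_maximalIdeal P.2.ne_top) with e | e
    · exact hPm e.symm
    · exact hPm (le_antisymm (IsLocalRing.le_maximalIdeal P.2.ne_top) hcon)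
  refine good_of_support (len_ρ P) r {q | (r : ℕ∞) ≤ Order.height q} ?_ N hN
  intro q hq
  by_cases hqP : q ≤ P
  · have : q = P := by
      by_contra hne
      have h1 := Order.height_add_one_le (lt_of_le_of_ne hqP hne)
      rw [hht] at h1
      have h2 : (r : ℕ∞) + 1 ≤ r := le_trans (by gcongr; exact hq) h1
      have h3 : r + 1 ≤ r := by exact_mod_cast h2
      omega
    subst this
    exact good_P rs h hm r hrs q hP x hx hxP hPm
  · obtain ⟨a, ha, haP⟩ : ∃ a ∈ q.asIdeal, a ∉ P.asIdeal := by
      by_contra! hcon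
      exact hqP hcon
    have hk : ∀ n : R ⧸ q.asIdeal, a • n = 0 := by
      intro n
      obtain ⟨n, rfl⟩ := Ideal.Quotient.mk_surjective n
      rw [Algebra.smul_def, Ideal.Quotient.algebraMap_eq, Ideal.Quotient.eq_zero_iff_mem.2 ha,
        zero_mul]
    have h0 : ρ P (R ⧸ q.asIdeal) = 0 := ρ_zero_of_smul P a haP hk
    have h1 : ∀ i, ρ P (E R i (R ⧸ q.asIdeal)) = 0 := fun i =>
      ρ_zero_of_smul P a haP (smul_E_eq_zero i a hk)
    refine ⟨?_, ?_, fun i _ => h1 i⟩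
    · change ρ P (R ⧸ q.asIdeal) ≠ ⊤
      rw [h0]; simp
    · change ρ P (E R r (R ⧸ q.asIdeal)) = ρ P (R ⧸ q.asIdeal)
      rw [h0, h1]
end Main2

/-- The abstract form of the theorem. -/
theorem abstract_main [IsNoetherianRing R] [IsLocalRing R] (rs : List R)
    (h : RingTheory.Sequence.IsWeaklyRegular R rs)
    (hm : Ideal.ofList rs = IsLocalRing.maximalIdeal R) (r : ℕ) (hrs : rs.length = r + 1)
    (hr : 1 ≤ r) (P : PrimeSpectrum R) (hht : Order.height P = (r : ℕ∞))
    (N : Type) [AddCommGroup N] [Module R N] [Module.Finite R N]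
    (hN : ∀ q : PrimeSpectrum R, Module.annihilator R N ≤ q.asIdeal → (r : ℕ∞) ≤ Order.height q) :
    IsFiniteLength (Localization P.asIdeal.primeCompl) (LocalizedModule P.asIdeal.primeCompl N) ∧
    IsFiniteLength (Localization P.asIdeal.primeCompl) (LocalizedModule P.asIdeal.primeCompl
      (((Ext R (ModuleCat R) r).obj (op (ModuleCat.of R N))).obj (ModuleCat.of R R))) ∧
    Order.krullDim (Submodule (Localization P.asIdeal.primeCompl)
      (LocalizedModule P.asIdeal.primeCompl
      (((Ext R (ModuleCat R) r).obj (op (ModuleCat.of R N))).obj (ModuleCat.of R R)))) =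
    Order.krullDim (Submodule (Localization P.asIdeal.primeCompl)
      (LocalizedModule P.asIdeal.primeCompl N)) := by
  obtain ⟨g1, g2, -⟩ := good_main rs h hm r hrs P hht N (fun q hq =>
    hN q (Module.mem_support_iff_of_finite.1 hq))
  beta_reduce at g1 g2
  obtain ⟨n, rfl⟩ := Nat.exists_eq_add_of_le' hr
  have e := (len_ρ P).congr (extEquiv (ModuleCat.of R N) (ModuleCat.of R R) n)
  beta_reduce at e
  have e' := e.trans g2
  refine ⟨Module.length_ne_top_iff.1 g1, Module.length_ne_top_iff.1 ?_, ?_⟩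
  · change ρ P _ ≠ ⊤
    rw [e']
    exact g1
  · rw [← Module.coe_length, ← Module.coe_length]
    exact congrArg _ e'

open scoped Pointwise
/-- regular local of dimension n, with a regular system of parameters -/
def Reg (n : ℕ) (R : Type) [CommRing R] : Prop :=
  ∃ _ : IsLocalRing R, ∃ rs : List R, rs.length = n ∧ RingTheory.Sequence.IsWeaklyRegular R rs ∧
    Ideal.ofList rs = IsLocalRing.maximalIdeal R

lemma Reg.congr {n : ℕ} {R S : Type} [CommRing R] [CommRing S] (h : Reg n R) (e : R ≃+* S) :
    Reg n S := by
  obtain ⟨hl, rs, h1, h2, h3⟩ := h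
  have hl' : IsLocalRing S := e.isLocalRing
  refine ⟨hl', rs.map e, by simpa using h1, ?_, ?_⟩
  · refine (AddEquiv.isWeaklyRegular_congr (e := e.toAddEquiv) (as := rs) (bs := rs.map e) ?_).1 h2
    rw [List.forall₂_map_right_iff, List.forall₂_same]
    intro x _ y
    simp
  · have := Ideal.map_ofList e.toRingHom rs
    rw [h3] at this
    refine Eq.trans this.symm ?_
    ext y
    obtain ⟨y, rfl⟩ := e.surjective y
    rw [show Ideal.map e.toRingHom (IsLocalRing.maximalIdeal R) = 
      Ideal.comap e.symm.toRingHom (IsLocalRing.maximalIdeal R) from Ideal.map_comap_of_equiv e]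
    simp

lemma Reg.powerSeries {n : ℕ} {R : Type} [CommRing R] (h : Reg n R) : Reg (n+1) (PowerSeries R) := by
  obtain ⟨hl, rs, h1, h2, h3⟩ := h
  refine ⟨inferInstance, PowerSeries.X :: rs.map (algebraMap R (PowerSeries R)), by simp [h1], ?_, ?_⟩
  · rw [RingTheory.Sequence.isWeaklyRegular_cons_iff]
    constructor
    · rw [isSMulRegular_iff_right_eq_zero_of_smul]
      intro f hf
      rw [smul_eq_mul] at hf
      ext k
      have := congrArg (PowerSeries.coeff (k+1)) hf
      simpa using this
    · rw [RingTheory.Sequence.isWeaklyRegular_map_algebraMap_iff]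
      let φ : PowerSeries R →ₗ[R] R := PowerSeries.coeff 0
      have hφ : Function.Surjective φ := fun a => ⟨PowerSeries.C a, by simp [φ]⟩
      have hk : LinearMap.ker φ = 
          ((PowerSeries.X : PowerSeries R) • (⊤ : Submodule (PowerSeries R) (PowerSeries R))).restrictScalars R := by
        ext f
        simp only [LinearMap.mem_ker, φ, Submodule.restrictScalars_mem, 
          Submodule.mem_smul_pointwise_iff_exists, PowerSeries.coeff_zero_eq_constantCoeff]
        change PowerSeries.constantCoeff f = 0 ↔ _
        rw [← PowerSeries.X_dvd_iff]
        simp [Dvd.dvd, eq_comm]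
      let e : QuotSMulTop (PowerSeries.X : PowerSeries R) (PowerSeries R) ≃ₗ[R] R :=
        (Submodule.Quotient.restrictScalarsEquiv R _).symm.trans
          ((Submodule.quotEquivOfEq _ _ hk.symm).trans (φ.quotKerEquivOfSurjective hφ))
      exact (e.isWeaklyRegular_congr rs).2 h2
  · rw [Ideal.ofList_cons, ← Ideal.map_ofList, h3]
    ext f
    have hf : f ∈ IsLocalRing.maximalIdeal (PowerSeries R) ↔
        PowerSeries.constantCoeff f ∈ IsLocalRing.maximalIdeal R := by
      rw [IsLocalRing.mem_maximalIdeal, IsLocalRing.mem_maximalIdeal, mem_nonunits_iff,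
        mem_nonunits_iff, PowerSeries.isUnit_iff_constantCoeff]
    rw [hf]
    constructor
    · intro h
      have hle : Ideal.span {PowerSeries.X} ⊔ Ideal.map (algebraMap R (PowerSeries R)) (IsLocalRing.maximalIdeal R)
          ≤ Ideal.comap PowerSeries.constantCoeff (IsLocalRing.maximalIdeal R) := by
        refine sup_le ?_ ?_
        · rw [Ideal.span_singleton_le_iff_mem]; simp
        · rw [Ideal.map_le_iff_le_comap]
          intro a ha
          simpa using ha
      exact hle h
    · intro h
      have : f = (f - PowerSeries.C (PowerSeries.constantCoeff f)) + 
        algebraMap R (PowerSeries R) (PowerSeries.constantCoeff f) := by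
          simp [PowerSeries.algebraMap_apply]
      rw [this, add_comm]
      refine Ideal.add_mem _ (Ideal.mem_sup_right (Ideal.mem_map_of_mem _ h)) 
        (Ideal.mem_sup_left ?_)
      rw [Ideal.mem_span_singleton, PowerSeries.X_dvd_iff]
      simp

lemma Reg.mvPowerSeries {R : Type} [CommRing R] (h : Reg 1 R) (r : ℕ) :
    Reg (r+1) (MvPowerSeries (Fin r) R) := by
  induction r with
  | zero => exact h.congr (MvPowerSeries.isEmptyEquiv (σ := Fin 0) (R := R)).symm.toRingEquiv
  | succ r ih => exact ih.powerSeries.congr (MvPowerSeries.finSuccEquiv R r).symm.toRingEquiv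

lemma reg_dvr {R : Type} [CommRing R] [IsDomain R] [IsDiscreteValuationRing R] : Reg 1 R := by
  obtain ⟨ϖ, hϖ⟩ := IsDiscreteValuationRing.exists_irreducible R
  refine ⟨inferInstance, [ϖ], rfl, ?_, ?_⟩
  · rw [RingTheory.Sequence.isWeaklyRegular_cons_iff]
    refine ⟨?_, RingTheory.Sequence.IsWeaklyRegular.nil _ _⟩
    rw [isSMulRegular_iff_right_eq_zero_of_smul]
    intro f hf
    rw [smul_eq_mul] at hf
    exact (mul_eq_zero.1 hf).resolve_left hϖ.ne_zero
  · rw [Ideal.ofList_singleton, hϖ.maximalIdeal_eq]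

section Padic
variable (p : ℕ) [Fact p.Prime] (K : Type) [Field K] [Algebra ℚ_[p] K]
  [Algebra ℤ_[p] K] [IsScalarTower ℤ_[p] ℚ_[p] K] [FiniteDimensional ℚ_[p] K]

lemma isIntegral_iff (y : K) : IsIntegral ℤ_[p] y ↔ spectralNorm ℚ_[p] K y ≤ 1 := by
  have hy : IsIntegral ℚ_[p] y := Algebra.IsIntegral.isIntegral y
  rw [spectralNorm, spectralValue_le_one_iff (minpoly.monic hy)]
  constructor
  · intro h n
    rw [minpoly.isIntegrallyClosed_eq_field_fractions' ℚ_[p] h, Polynomial.coeff_map]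
    exact PadicInt.norm_le_one _
  · intro h
    have hl : minpoly ℚ_[p] y ∈ Polynomial.lifts (algebraMap ℤ_[p] ℚ_[p]) := by
      rw [Polynomial.lifts_iff_coeff_lifts]
      intro n
      exact ⟨⟨_, h n⟩, rfl⟩
    obtain ⟨q, hq, -, hmon⟩ := Polynomial.lifts_and_natDegree_eq_and_monic hl (minpoly.monic hy)
    refine ⟨q, hmon, ?_⟩
    have h1 := minpoly.aeval ℚ_[p] y
    rw [← hq, Polynomial.aeval_map_algebraMap] at h1
    exact h1

lemma isLocalRing_integralClosure : IsLocalRing (integralClosure ℤ_[p] K) := by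
  have hmul : ∀ a b : K, spectralNorm ℚ_[p] K (a * b) = spectralNorm ℚ_[p] K a * spectralNorm ℚ_[p] K b :=
    fun a b => spectralAlgNorm_mul a b
  have hone : spectralNorm ℚ_[p] K 1 = 1 := spectralNorm_one
  have hunit : ∀ a : integralClosure ℤ_[p] K, a ∈ nonunits (integralClosure ℤ_[p] K) ↔ 
      spectralNorm ℚ_[p] K a.1 < 1 := by
    intro a
    have ha := (isIntegral_iff p K a.1).1 a.2
    constructor
    · intro hn
      refine lt_of_le_of_ne ha ?_
      intro h1
      apply hn
      have h0 : a.1 ≠ 0 := by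
        intro h0
        rw [h0, spectralNorm_zero] at h1
        exact zero_ne_one h1
      have hinv : spectralNorm ℚ_[p] K (a.1)⁻¹ ≤ 1 := by
        have := hmul a.1 (a.1)⁻¹
        rw [mul_inv_cancel₀ h0, hone, h1, one_mul] at this
        exact this.ge
      refine IsUnit.of_mul_eq_one ⟨(a.1)⁻¹, (isIntegral_iff p K _).2 hinv⟩ ?_
      exact Subtype.ext (mul_inv_cancel₀ h0)
    · rintro hlt ⟨u, rfl⟩
      have h2 := hmul (u.1).1 (u⁻¹).1.1
      have h3 : (u.1).1 * (u⁻¹).1.1 = 1 := congrArg Subtype.val u.mul_inv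
      have h4 := (isIntegral_iff p K (u⁻¹).1.1).1 (u⁻¹).1.2
      rw [h3, hone] at h2
      have h5 := spectralNorm_nonneg (K := ℚ_[p]) (u.1).1
      nlinarith [spectralNorm_nonneg (K := ℚ_[p]) (u⁻¹).1.1]
  refine IsLocalRing.of_nonunits_add ?_
  intro a b ha hb
  rw [hunit] at *
  exact lt_of_le_of_lt (isNonarchimedean_spectralNorm a.1 b.1) (max_lt ha hb)

lemma dedekind_O : IsDedekindDomain (integralClosure ℤ_[p] K) :=
  integralClosure.isDedekindDomain ℤ_[p] ℚ_[p] K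

lemma dvr_O : IsDiscreteValuationRing (integralClosure ℤ_[p] K) := by
  have := isLocalRing_integralClosure p K
  have hD := dedekind_O p K
  have hinj : Function.Injective (algebraMap ℤ_[p] K) := by
    rw [IsScalarTower.algebraMap_eq ℤ_[p] ℚ_[p] K]
    exact (algebraMap ℚ_[p] K).injective.comp (IsFractionRing.injective ℤ_[p] ℚ_[p])
  have hinj' : Function.Injective (algebraMap ℤ_[p] (integralClosure ℤ_[p] K)) := by
    intro a b hab
    exact hinj (congrArg Subtype.val hab)
  have hnf : ¬ IsField (integralClosure ℤ_[p] K) := by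
    intro hF
    have : FaithfulSMul ℤ_[p] (integralClosure ℤ_[p] K) :=
      (faithfulSMul_iff_algebraMap_injective _ _).2 hinj'
    exact IsDiscreteValuationRing.not_isField ℤ_[p] (isField_of_isIntegral_of_isField hinj' hF)
  exact ((IsDiscreteValuationRing.TFAE (integralClosure ℤ_[p] K) hnf).out 0 2).2 hD

lemma reg_Λ (r : ℕ) : Reg (r+1) (MvPowerSeries (Fin r) (integralClosure ℤ_[p] K)) := by
  have := dvr_O p K
  exact reg_dvr.mvPowerSeries r

lemma noeth_Λ (r : ℕ) : IsNoetherianRing (MvPowerSeries (Fin r) (integralClosure ℤ_[p] K)) := by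
  have := dvr_O p K
  infer_instance
end Padic

end S15

section Statement15

variable (p : ℕ) [Fact p.Prime] (K : Type) [Field K] [Algebra ℚ_[p] K]
  [Algebra ℤ_[p] K] [IsScalarTower ℤ_[p] ℚ_[p] K] [FiniteDimensional ℚ_[p] K] (r : ℕ)

local notation "Λ" => IwasawaAlgebra p K r

/-- Let `M` be a small `Λ`-module and let `P` be a height-`r` prime
ideal of `Λ`.  Then the localizations `M_P` and `(Ext^r_Λ(M,Λ))_P` are `Λ_P`-modules of
finite length, and `length_{Λ_P}((Ext^r_Λ(M,Λ))_P) = length_{Λ_P}(M_P)`; thus the Iwasawa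
adjoint `α(M) = Ext^r_Λ(M,Λ)` and `M` have the same length at every height-`r` prime of
`Λ`, i.e. the same `r`-th localized Chern class. -/
theorem statement15 (hr : 1 ≤ r)
    (M : Type) [AddCommGroup M] [Module Λ M] [Module.Finite Λ M]
    (hsmall : (r : ℕ∞) ≤ idealHeight (Module.annihilator Λ M))
    (P : PrimeSpectrum Λ) (hht : Order.height P = (r : ℕ∞)) :
    IsFiniteLength (Localization P.asIdeal.primeCompl)
      (LocalizedModule P.asIdeal.primeCompl M) ∧
    IsFiniteLength (Localization P.asIdeal.primeCompl)
      (LocalizedModule P.asIdeal.primeCompl (ExtGroup Λ r M Λ)) ∧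
    modLength (Localization P.asIdeal.primeCompl)
        (LocalizedModule P.asIdeal.primeCompl (ExtGroup Λ r M Λ)) =
      modLength (Localization P.asIdeal.primeCompl)
        (LocalizedModule P.asIdeal.primeCompl M) := by
  have := S15.noeth_Λ p K r
  obtain ⟨hl, rs, h1, h2, h3⟩ := S15.reg_Λ p K r
  exact S15.abstract_main rs h2 h3 r h1 hr P hht M
    (fun q hq => hsmall.trans
      (iInf_le (fun P : {P : PrimeSpectrum _ // Module.annihilator _ M ≤ P.asIdeal} =>
        Order.height P.1) ⟨q, hq⟩))

end Statement15
end
end
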